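/- Let 0 < μ < μ'. Define D_μ := {(z₁,z₂,z₃) ∈ ℂ³ : z₂ ≠ 0, z₃ ≠ 0, Re(z₁·exp(−i·log|z₂z₃|²)) > 0, −μ < log|z₂|² < μ, −μ < log|z₃|² < μ}, and similarly D_{μ'}. Then for every function F : ℂ³ → ℂ holomorphic and square-integrable on D_μ and every ε > 0, there exists a function G : ℂ³ → ℂ holomorphic and square-integrable on D_{μ'} such that ∫_{D_μ} |G − F|² dV < ε. In other words, the restriction map from the Bergman space A²(D_{μ'}) to A²(D_μ) has dense image. -/

import Mathlib

open Complex MeasureTheory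

/-- The model worm `D_μ`. -/
noncomputable def Dmod (μ : ℝ) : Set (ℂ × ℂ × ℂ) :=
  {z | z.2.1 ≠ 0 ∧ z.2.2 ≠ 0 ∧
    0 < (z.1 * Complex.exp (-(Complex.I *
      ((Real.log (‖z.2.1 * z.2.2‖ ^ 2) : ℝ) : ℂ)))).re ∧
    -μ < Real.log (‖z.2.1‖ ^ 2) ∧ Real.log (‖z.2.1‖ ^ 2) < μ ∧
    -μ < Real.log (‖z.2.2‖ ^ 2) ∧ Real.log (‖z.2.2‖ ^ 2) < μ}

namespace Worm

open Topology Filter Metric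

/-- exponential chart -/
noncomputable def Ex (w : ℂ × ℂ × ℂ) : ℂ × ℂ × ℂ :=
  (exp w.1, exp (I * w.2.1), exp (I * w.2.2))

/-- complexification of a real vector -/
def cv (v : ℝ × ℝ × ℝ) : ℂ × ℂ × ℂ := ((v.1 : ℂ), (v.2.1 : ℂ), (v.2.2 : ℂ))

lemma Ex_add (w w' : ℂ × ℂ × ℂ) : Ex (w + w') = Ex w * Ex w' := by
  simp [Ex, mul_add, exp_add]

lemma Ex_zero : Ex 0 = 1 := by
  simp [Ex]

lemma cv_add (v v' : ℝ × ℝ × ℝ) : cv (v + v') = cv v + cv v' := by simp [cv]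

lemma cv_zero : cv 0 = 0 := by simp [cv]

lemma cv_cont : Continuous cv := by unfold cv; fun_prop

lemma Ex_diff : Differentiable ℂ Ex := by unfold Ex; fun_prop

lemma Ex_cont : Continuous Ex := Ex_diff.continuous

/-- tube -/
def Tube (μ : ℝ) : Set (ℂ × ℂ × ℂ) :=
  {w | |w.1.im + 2 * w.2.1.im + 2 * w.2.2.im| < Real.pi / 2 ∧ |2 * w.2.1.im| < μ ∧
    |2 * w.2.2.im| < μ}

lemma Tube_open (μ : ℝ) : IsOpen (Tube μ) := by
  have h1 : IsOpen {w : ℂ × ℂ × ℂ | |w.1.im + 2 * w.2.1.im + 2 * w.2.2.im| < Real.pi / 2} :=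
    isOpen_lt (by fun_prop) (by fun_prop)
  have h2 : IsOpen {w : ℂ × ℂ × ℂ | |2 * w.2.1.im| < μ} := isOpen_lt (by fun_prop) (by fun_prop)
  have h3 : IsOpen {w : ℂ × ℂ × ℂ | |2 * w.2.2.im| < μ} := isOpen_lt (by fun_prop) (by fun_prop)
  exact h1.inter (h2.inter h3)

lemma Tube_convex (μ : ℝ) : Convex ℝ (Tube μ) := by
  intro x hx y hy a b ha hb hab
  obtain ⟨h1, h2, h3⟩ := hx
  obtain ⟨k1, k2, k3⟩ := hy
  rw [abs_lt] at h1 h2 h3 k1 k2 k3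
  have key : ∀ s t c : ℝ, (-c < s ∧ s < c) → (-c < t ∧ t < c) → |a * s + b * t| < c := by
    intro s t c hs ht
    rw [abs_lt]
    have := (convex_Ioo (-c) c) (x := s) hs (y := t) ht ha hb hab
    simpa using this
  refine ⟨?_, ?_, ?_⟩
  · have := key _ _ _ h1 k1
    simp only [Prod.fst_add, Prod.smul_fst, add_im, smul_im, Prod.snd_add, Prod.smul_snd,
      smul_eq_mul]
    convert this using 2
    ring
  · have := key _ _ _ h2 k2
    simp only [Prod.fst_add, Prod.smul_fst, add_im, smul_im, Prod.snd_add, Prod.smul_snd,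
      smul_eq_mul]
    convert this using 2
    ring
  · have := key _ _ _ h3 k3
    simp only [Prod.smul_fst, add_im, smul_im, Prod.snd_add, Prod.smul_snd,
      smul_eq_mul]
    convert this using 2
    ring

lemma Tube_add_cv {μ : ℝ} {w : ℂ × ℂ × ℂ} (v : ℝ × ℝ × ℝ) :
    w + cv v ∈ Tube μ ↔ w ∈ Tube μ := by
  simp [Tube, cv]

lemma zero_mem_Tube {μ : ℝ} (hμ : 0 < μ) : (0 : ℂ × ℂ × ℂ) ∈ Tube μ := by
  simp [Tube, hμ, Real.pi_pos]

lemma norm_expI (w : ℂ) : Real.log (‖exp (I * w)‖ ^ 2) = - 2 * w.im := by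
  rw [norm_exp, ← Real.exp_nat_mul, Real.log_exp]; simp

lemma norm_expI2 (w w' : ℂ) :
    Real.log (‖exp (I * w) * exp (I * w')‖ ^ 2) = - 2 * w.im - 2 * w'.im := by
  rw [← exp_add, ← mul_add, norm_expI]; simp; ring

lemma Ex_mem {μ : ℝ} {w : ℂ × ℂ × ℂ} (hw : w ∈ Tube μ) : Ex w ∈ Dmod μ := by
  obtain ⟨h1, h2, h3⟩ := hw
  rw [abs_lt] at h2 h3
  refine ⟨exp_ne_zero _, exp_ne_zero _, ?_, ?_⟩
  · simp only [Ex]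
    rw [norm_expI2, ← exp_add, exp_re]
    apply mul_pos (Real.exp_pos _)
    apply Real.cos_pos_of_mem_Ioo
    rw [abs_lt] at h1
    simp
    constructor <;> linarith
  · simp only [Ex]
    rw [norm_expI, norm_expI]
    refine ⟨?_, ?_, ?_, ?_⟩ <;> linarith

lemma D_mul_iff {μ : ℝ} (v : ℝ × ℝ × ℝ) (z : ℂ × ℂ × ℂ) :
    Ex (cv v) * z ∈ Dmod μ ↔ z ∈ Dmod μ := by
  have h1 : ∀ x : ℝ, ‖exp (I * x)‖ = 1 := fun x => by rw [mul_comm]; exact norm_exp_ofReal_mul_I x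
  simp only [Dmod, Ex, cv, Set.mem_ofPred_eq, Prod.fst_mul, Prod.snd_mul, norm_mul, h1, one_mul,
    exp_ne_zero, ne_eq, mul_assoc, ← ofReal_exp,
    re_ofReal_mul, mul_pos_iff_of_pos_left (Real.exp_pos _), mul_eq_zero, false_or]

lemma D_open (μ : ℝ) : IsOpen (Dmod μ) := by
  have h0 : IsOpen {z : ℂ × ℂ × ℂ | z.2.1 ≠ 0 ∧ z.2.2 ≠ 0} :=
    (isOpen_ne_fun (by fun_prop) (by fun_prop)).inter (isOpen_ne_fun (by fun_prop) (by fun_prop))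
  rw [isOpen_iff_mem_nhds]
  intro z hz
  obtain ⟨a, b, c, d, e, f, g⟩ := hz
  have c1 : ContinuousAt (fun z : ℂ × ℂ × ℂ => Real.log (‖z.2.1‖ ^ 2)) z :=
    ContinuousAt.log (by fun_prop) (by simpa using a)
  have c2 : ContinuousAt (fun z : ℂ × ℂ × ℂ => Real.log (‖z.2.2‖ ^ 2)) z :=
    ContinuousAt.log (by fun_prop) (by simpa using b)
  have c3 : ContinuousAt (fun z : ℂ × ℂ × ℂ => Real.log (‖z.2.1 * z.2.2‖ ^ 2)) z :=
    ContinuousAt.log (by fun_prop) (by simp [a, b])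
  have c4 : ContinuousAt (fun z : ℂ × ℂ × ℂ => (z.1 * Complex.exp (-(Complex.I *
      ((Real.log (‖z.2.1 * z.2.2‖ ^ 2) : ℝ) : ℂ)))).re) z := by fun_prop
  filter_upwards [h0.mem_nhds ⟨a, b⟩, c4.eventually (lt_mem_nhds c), c1.eventually (lt_mem_nhds d),
    c1.eventually (gt_mem_nhds e), c2.eventually (lt_mem_nhds f), c2.eventually (gt_mem_nhds g)]
    with y h1 h2 h3 h4 h5 h6
  exact ⟨h1.1, h1.2, h2, h3, h4, h5, h6⟩

/-- the angle -/
noncomputable def th (z : ℂ × ℂ × ℂ) : ℝ := Real.log (‖z.2.1 * z.2.2‖ ^ 2)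

/-- logarithmic chart -/
noncomputable def Lam (z : ℂ × ℂ × ℂ) : ℂ × ℂ × ℂ :=
  (log (z.1 * exp (-(I * (th z : ℂ)))) + I * th z, -I * log z.2.1, -I * log z.2.2)

lemma D_fst_ne {μ : ℝ} {z : ℂ × ℂ × ℂ} (hz : z ∈ Dmod μ) : z.1 ≠ 0 := by
  intro h
  have := hz.2.2.1
  simp [h] at this

lemma D_mono {μ μ' : ℝ} (h : μ ≤ μ') : Dmod μ ⊆ Dmod μ' := by
  rintro z ⟨a, b, c, d, e, f, g⟩
  exact ⟨a, b, c, by linarith, by linarith, by linarith, by linarith⟩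

lemma Ex_Lam {μ : ℝ} {z : ℂ × ℂ × ℂ} (hz : z ∈ Dmod μ) : Ex (Lam z) = z := by
  have h1 := D_fst_ne hz
  have e : ∀ x : ℂ, I * (-I * x) = x := fun x => by
    rw [← mul_assoc]; simp
  simp only [Ex, Lam, e, exp_log hz.1, exp_log hz.2.1]
  rw [exp_add, exp_log (mul_ne_zero h1 (exp_ne_zero _)), mul_assoc, ← exp_add]
  simp

lemma Lam_mem {μ : ℝ} {z : ℂ × ℂ × ℂ} (hz : z ∈ Dmod μ) : Lam z ∈ Tube μ := by
  obtain ⟨a, b, c, d, e, f, g⟩ := hz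
  have ea : Real.log (‖z.2.1‖ ^ 2) = 2 * Real.log ‖z.2.1‖ := by simp
  have eb : Real.log (‖z.2.2‖ ^ 2) = 2 * Real.log ‖z.2.2‖ := by simp
  have et : th z = 2 * Real.log ‖z.2.1‖ + 2 * Real.log ‖z.2.2‖ := by
    unfold th
    rw [norm_mul, mul_pow, Real.log_mul (by simpa using a) (by simpa using b), ea, eb]
  have harg : |arg (z.1 * exp (-(I * (th z : ℂ))))| < Real.pi / 2 :=
    abs_arg_lt_pi_div_two_iff.2 (Or.inl c)
  refine ⟨?_, ?_, ?_⟩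
  · convert harg using 2
    simp [Lam, log_im, log_re]
    linarith
  · rw [abs_lt]; simp [Lam, log_re]; constructor <;> linarith
  · rw [abs_lt]; simp [Lam, log_re]; constructor <;> linarith

lemma Lam_re {z : ℂ × ℂ × ℂ} : (Lam z).1.re = Real.log ‖z.1‖ := by
  have : ‖exp (-(I * (th z : ℂ)))‖ = 1 := by
    rw [norm_exp]; simp
  simp [Lam, log_re, this]

lemma Lam_meas : Measurable Lam := by
  unfold Lam th
  fun_prop

lemma holo_Lam {μ : ℝ} {h : ℂ × ℂ × ℂ → ℂ} (hd : Differentiable ℂ h)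
    (hp : ∀ w w' : ℂ × ℂ × ℂ, w.1 = w'.1 → exp (I * w.2.1) = exp (I * w'.2.1) →
      exp (I * w.2.2) = exp (I * w'.2.2) → h w = h w') :
    DifferentiableOn ℂ (fun z => h (Lam z)) (Dmod μ) := by
  intro z0 hz0
  apply DifferentiableAt.differentiableWithinAt
  have e : ∀ x : ℂ, I * (-I * x) = x := fun x => by
    rw [← mul_assoc]; simp
  have n2 := hz0.1
  have n3 := hz0.2.1
  have n1 := D_fst_ne hz0
  set L : ℂ × ℂ × ℂ → ℂ × ℂ × ℂ := fun z =>
    (log (z.1 * exp (-(I * (th z0 : ℂ)))) + I * th z0, -I * (log (z.2.1 / z0.2.1) + log z0.2.1),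
      -I * (log (z.2.2 / z0.2.2) + log z0.2.2)) with hL
  have hLd : DifferentiableAt ℂ L z0 := by
    have s1 : z0.1 * exp (-(I * (th z0 : ℂ))) ∈ slitPlane := Or.inl hz0.2.2.1
    have s2 : z0.2.1 / z0.2.1 ∈ slitPlane := by rw [div_self n2]; exact one_mem_slitPlane
    have s3 : z0.2.2 / z0.2.2 ∈ slitPlane := by rw [div_self n3]; exact one_mem_slitPlane
    have d1 : DifferentiableAt ℂ (fun z : ℂ × ℂ × ℂ => log (z.1 * exp (-(I * (th z0 : ℂ))))) z0 :=
      DifferentiableAt.clog (by fun_prop) s1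
    have d2 : DifferentiableAt ℂ (fun z : ℂ × ℂ × ℂ => log (z.2.1 / z0.2.1)) z0 :=
      DifferentiableAt.clog (by fun_prop) s2
    have d3 : DifferentiableAt ℂ (fun z : ℂ × ℂ × ℂ => log (z.2.2 / z0.2.2)) z0 :=
      DifferentiableAt.clog (by fun_prop) s3
    fun_prop
  have hcomp : DifferentiableAt ℂ (fun z => h (L z)) z0 := (hd _).comp z0 hLd
  refine hcomp.congr_of_eventuallyEq ?_
  have cth : ContinuousAt th z0 :=
    ContinuousAt.log (by fun_prop) (by simp [n2, n3])
  have ev : ∀ᶠ z in 𝓝 z0, |th z - th z0| < Real.pi / 2 := by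
    have : ContinuousAt (fun z => |th z - th z0|) z0 := by fun_prop
    exact this.eventually (gt_mem_nhds (by simp [Real.pi_pos]))
  filter_upwards [(D_open μ).mem_nhds hz0, ev] with z hz hth
  have m2 := hz.1
  have m3 := hz.2.1
  have m1 := D_fst_ne hz
  apply hp
  · simp only [Lam, hL]
    set u := z.1 * exp (-(I * (th z : ℂ))) with hu
    have hu0 : u ≠ 0 := mul_ne_zero m1 (exp_ne_zero _)
    have harg : |arg u| < Real.pi / 2 := abs_arg_lt_pi_div_two_iff.2 (Or.inl hz.2.2.1)
    have : z.1 * exp (-(I * (th z0 : ℂ))) = exp (log u + I * (th z - th z0 : ℝ)) := by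
      rw [exp_add, exp_log hu0, hu, mul_assoc, ← exp_add]
      congr 2
      push_cast; ring
    rw [abs_lt] at harg hth
    rw [this, log_exp]
    · push_cast; ring
    · simp [log_im]; linarith
    · simp [log_im]; linarith
  · simp only [Lam, hL, e, exp_add, exp_log m2, exp_log n2, exp_log (div_ne_zero m2 n2)]
    field_simp
  · simp only [Lam, hL, e, exp_add, exp_log m3, exp_log n3, exp_log (div_ne_zero m3 n3)]
    field_simp

end Worm

namespace Worm

open Topology Filter Metric Set
open scoped ENNReal

instance haarC3 : (volume : Measure (ℂ × ℂ × ℂ)).IsAddLeftInvariant := by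
  have h2 : ((volume : Measure ℂ).prod (volume : Measure ℂ)).IsAddLeftInvariant := inferInstance
  have h3 : ((volume : Measure ℂ).prod
    ((volume : Measure ℂ).prod (volume : Measure ℂ))).IsAddLeftInvariant :=
      Measure.prod.instIsAddLeftInvariant
  exact h3

instance haarR3 : (volume : Measure (ℝ × ℝ × ℝ)).IsAddLeftInvariant := by
  have h2 : ((volume : Measure ℝ).prod (volume : Measure ℝ)).IsAddLeftInvariant := inferInstance
  have h3 : ((volume : Measure ℝ).prod
    ((volume : Measure ℝ).prod (volume : Measure ℝ))).IsAddLeftInvariant :=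
      Measure.prod.instIsAddLeftInvariant
  exact h3

lemma map_mul1 (c : ℂ) (hc : c ≠ 0) :
    Measure.map (fun z : ℂ => c * z) volume = ENNReal.ofReal ((‖c‖ ^ 2)⁻¹) • volume := by
  have hdet : LinearMap.det (LinearMap.mulLeft ℝ c) = ‖c‖ ^ 2 := by
    have := Algebra.norm_complex_apply c
    rw [Algebra.norm_apply] at this
    rw [← normSq_eq_norm_sq, ← this]
    rfl
  have h := Measure.map_linearMap_addHaar_eq_smul_addHaar (volume : Measure ℂ)
    (f := LinearMap.mulLeft ℝ c) (by rw [hdet]; positivity)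
  rw [hdet, abs_of_nonneg (by positivity)] at h
  exact h

lemma map_mul3 (l : ℂ × ℂ × ℂ) (h1 : l.1 ≠ 0) (h2 : ‖l.2.1‖ = 1) (h3 : ‖l.2.2‖ = 1) :
    Measure.map (fun z : ℂ × ℂ × ℂ => l * z) volume
      = ENNReal.ofReal ((‖l.1‖ ^ 2)⁻¹) • volume := by
  have e2 := map_mul1 l.2.1 (by rw [← norm_pos_iff, h2]; norm_num)
  have e3 := map_mul1 l.2.2 (by rw [← norm_pos_iff, h3]; norm_num)
  have e1 := map_mul1 l.1 h1
  simp only [h2, h3, one_pow, inv_one, ENNReal.ofReal_one, one_smul] at e2 e3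
  have m1 : ∀ c : ℂ, Measurable (fun z : ℂ => c * z) := fun c => by fun_prop
  have hv2 : (volume : Measure (ℂ × ℂ)) = (volume : Measure ℂ).prod volume := rfl
  have hv3 : (volume : Measure (ℂ × ℂ × ℂ)) = (volume : Measure ℂ).prod volume := rfl
  have h23 : Measure.map (Prod.map (fun z : ℂ => l.2.1 * z) (fun z : ℂ => l.2.2 * z))
      (volume : Measure (ℂ × ℂ)) = volume := by
    rw [hv2, ← Measure.map_prod_map _ _ (m1 _) (m1 _), e2, e3]
  have : (fun z : ℂ × ℂ × ℂ => l * z) = Prod.map (fun z : ℂ => l.1 * z)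
      (Prod.map (fun z : ℂ => l.2.1 * z) (fun z : ℂ => l.2.2 * z)) := rfl
  rw [this, hv3, ← Measure.map_prod_map _ _ (m1 _) ((m1 _).prodMap (m1 _)), h23, e1,
    Measure.prod_smul_left]

lemma lint_mul3 (l : ℂ × ℂ × ℂ) (h1 : l.1 ≠ 0) (h2 : ‖l.2.1‖ = 1) (h3 : ‖l.2.2‖ = 1)
    (f : ℂ × ℂ × ℂ → ℝ≥0∞) (hf : Measurable f) :
    ∫⁻ z, f (l * z) = ENNReal.ofReal ((‖l.1‖ ^ 2)⁻¹) * ∫⁻ z, f z := by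
  have hm : Measurable (fun z : ℂ × ℂ × ℂ => l * z) := by fun_prop
  rw [← lintegral_map hf hm, map_mul3 l h1 h2 h3, lintegral_smul_measure, smul_eq_mul]

/-- group action -/
noncomputable def U (F : ℂ × ℂ × ℂ → ℂ) (v : ℝ × ℝ × ℝ) (z : ℂ × ℂ × ℂ) : ℂ :=
  exp (v.1 : ℂ) * F (Ex (cv v) * z)

lemma U_meas {F : ℂ × ℂ × ℂ → ℂ} (hF : Measurable F) :
    Measurable (fun p : (ℝ × ℝ × ℝ) × (ℂ × ℂ × ℂ) => U F p.1 p.2) := by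
  unfold U
  have : Measurable (fun p : (ℝ × ℝ × ℝ) × (ℂ × ℂ × ℂ) => Ex (cv p.1) * p.2) :=
    ((Ex_cont.comp (cv_cont.comp continuous_fst)).mul continuous_snd).measurable
  have h2 := hF.comp this
  have h3 : Measurable (fun p : (ℝ × ℝ × ℝ) × (ℂ × ℂ × ℂ) => exp (p.1.1 : ℂ)) := by fun_prop
  exact h3.mul h2

lemma U_meas' {F : ℂ × ℂ × ℂ → ℂ} (hF : Measurable F) (v : ℝ × ℝ × ℝ) :
    Measurable (U F v) :=
  (U_meas hF).comp (measurable_const.prodMk measurable_id)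

lemma norm_Ex_cv (x : ℝ) : ‖exp (I * x)‖ = 1 := by rw [mul_comm]; exact norm_exp_ofReal_mul_I x

lemma U_unitary {F : ℂ × ℂ × ℂ → ℂ} (hF : Measurable F) (v : ℝ × ℝ × ℝ) :
    ∫⁻ z, ‖U F v z‖ₑ ^ 2 = ∫⁻ z, ‖F z‖ₑ ^ 2 := by
  have hm : Measurable (fun z => ‖F z‖ₑ ^ 2) := by fun_prop
  simp only [U, enorm_mul, mul_pow]
  rw [lintegral_const_mul _ (by
      have : Measurable (fun z => Ex (cv v) * z) := by fun_prop
      exact hm.comp this),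
    lint_mul3 (Ex (cv v)) (exp_ne_zero _) (norm_Ex_cv _) (norm_Ex_cv _) _ hm, ← mul_assoc]
  have : ‖exp (v.1 : ℂ)‖ₑ ^ 2 * ENNReal.ofReal ((‖(Ex (cv v)).1‖ ^ 2)⁻¹) = 1 := by
    have h0 : (0:ℝ) < ‖exp (v.1 : ℂ)‖ := norm_pos_iff.2 (exp_ne_zero _)
    rw [← ofReal_norm, ← ENNReal.ofReal_pow (norm_nonneg _),
      ← ENNReal.ofReal_mul (by positivity)]
    simp only [Ex, cv]
    rw [mul_inv_cancel₀ (by positivity), ENNReal.ofReal_one]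
  rw [this, one_mul]

lemma U_tendsto {μ : ℝ} {F : ℂ × ℂ × ℂ → ℂ} (hm : Measurable F) (hF : ContinuousOn F (Dmod μ))
    (h0 : ∀ z, z ∉ Dmod μ → F z = 0) (hN : ∫⁻ z, ‖F z‖ₑ ^ 2 ≠ ∞)
    {v : ℕ → ℝ × ℝ × ℝ} (hv : Tendsto v atTop (𝓝 0)) :
    Tendsto (fun n => ∫⁻ z, ‖U F (v n) z - F z‖ₑ ^ 2) atTop (𝓝 0) := by
  set N := ∫⁻ z, ‖F z‖ₑ ^ 2 with hNd
  have hpt : ∀ z, Tendsto (fun n => U F (v n) z) atTop (𝓝 (F z)) := by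
    intro z
    by_cases hz : z ∈ Dmod μ
    · have c1 : ContinuousAt F z := hF.continuousAt ((D_open μ).mem_nhds hz)
      have t1 : Tendsto (fun n => Ex (cv (v n)) * z) atTop (𝓝 z) := by
        have c2 : Continuous (fun v => Ex (cv v) * z) :=
          (Ex_cont.comp cv_cont).mul continuous_const
        have := (c2.tendsto 0).comp hv
        simpa [cv_zero, Ex_zero, Function.comp_def] using this
      have t2 := c1.tendsto.comp t1
      have t3 : Tendsto (fun n => exp ((v n).1 : ℂ)) atTop (𝓝 1) := by
        have c2 : Continuous (fun v : ℝ × ℝ × ℝ => exp (v.1 : ℂ)) := by fun_prop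
        have := (c2.tendsto 0).comp hv
        simpa [Function.comp_def] using this
      simpa [U] using t3.mul t2
    · have : ∀ n, U F (v n) z = F z := by
        intro n
        rw [U, h0 z hz, h0 _ (by rwa [D_mul_iff]), mul_zero]
      simp [this]
  have par : ∀ n, (∫⁻ z, ‖U F (v n) z - F z‖ₑ ^ 2) + ∫⁻ z, ‖U F (v n) z + F z‖ₑ ^ 2 = 4 * N := by
    intro n
    have m1 := U_meas' hm (v n)
    rw [← lintegral_add_left (by fun_prop)]
    have : ∀ z, ‖U F (v n) z - F z‖ₑ ^ 2 + ‖U F (v n) z + F z‖ₑ ^ 2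
        = 2 * ‖U F (v n) z‖ₑ ^ 2 + 2 * ‖F z‖ₑ ^ 2 := by
      intro z
      have h2 : (2 : ℝ≥0∞) = ENNReal.ofReal 2 := by simp
      simp only [← ofReal_norm]
      simp only [h2, ← ENNReal.ofReal_pow (norm_nonneg _)]
      rw [← ENNReal.ofReal_mul (by norm_num), ← ENNReal.ofReal_mul (by norm_num),
        ← ENNReal.ofReal_add (by positivity) (by positivity),
        ← ENNReal.ofReal_add (by positivity) (by positivity)]
      congr 1
      have := parallelogram_law_with_norm ℝ (U F (v n) z) (F z)
      nlinarith
    simp_rw [this]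
    rw [lintegral_add_left (by fun_prop), lintegral_const_mul _ (by fun_prop),
      lintegral_const_mul _ (by fun_prop), U_unitary hm, ← hNd, ← add_mul]
    norm_num
  have fatou : 4 * N ≤ liminf (fun n => ∫⁻ z, ‖U F (v n) z + F z‖ₑ ^ 2) atTop := by
    have h := lintegral_liminf_le (μ := (volume : Measure (ℂ × ℂ × ℂ))) (u := atTop)
      (f := fun n z => ‖U F (v n) z + F z‖ₑ ^ 2)
      (fun n => by have m1 := U_meas' hm (v n); fun_prop)
    refine le_trans (le_of_eq ?_) h
    have : ∀ z, liminf (fun n => ‖U F (v n) z + F z‖ₑ ^ 2) atTop = 4 * ‖F z‖ₑ ^ 2 := by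
      intro z
      have t : Tendsto (fun n => ‖U F (v n) z + F z‖ₑ ^ 2) atTop (𝓝 (‖F z + F z‖ₑ ^ 2)) := by
        have := ((hpt z).add_const (F z)).enorm
        exact ((ENNReal.continuous_pow 2).tendsto _).comp this
      rw [t.liminf_eq, ← two_mul, enorm_mul, mul_pow]
      congr 1
      rw [← ofReal_norm]
      norm_num
    simp_rw [this]
    rw [lintegral_const_mul _ (by fun_prop)]
  have hfin : 4 * N ≠ ∞ := ENNReal.mul_ne_top (by norm_num) hN
  have hle : ∀ n, (∫⁻ z, ‖U F (v n) z + F z‖ₑ ^ 2) ≤ 4 * N := fun n => by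
    rw [← par n]; exact le_add_self
  have tpsi : Tendsto (fun n => ∫⁻ z, ‖U F (v n) z + F z‖ₑ ^ 2) atTop (𝓝 (4 * N)) := by
    refine tendsto_of_le_liminf_of_limsup_le fatou ?_
    exact limsup_le_of_le (h := Eventually.of_forall hle)
  have eq : ∀ n, (∫⁻ z, ‖U F (v n) z - F z‖ₑ ^ 2)
      = 4 * N - ∫⁻ z, ‖U F (v n) z + F z‖ₑ ^ 2 := by
    intro n
    rw [← par n, ENNReal.add_sub_cancel_right]
    exact ((hle n).trans_lt hfin.lt_top).ne
  simp_rw [eq]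
  have := ENNReal.Tendsto.sub (tendsto_const_nhds (x := 4 * N) (f := atTop (α := ℕ))) tpsi
    (Or.inl hfin)
  simpa using this

/-- local mean value inequality -/
lemma bergman {D : Set (ℂ × ℂ × ℂ)} {F : ℂ × ℂ × ℂ → ℂ} (hm : Measurable F)
    (hF : DifferentiableOn ℂ F D)
    {c : ℂ × ℂ × ℂ} {δ : ℝ} (hb : ball c δ ⊆ D) :
    volume (ball (0 : ℂ × ℂ × ℂ) δ) * ‖F c‖ₑ ^ 2 ≤ ∫⁻ z, ‖F z‖ₑ ^ 2 := by
  have hFb : DifferentiableOn ℂ F (ball c δ) := hF.mono hb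
  set B := ball (0 : ℂ × ℂ × ℂ) δ with hB
  have h2pi : (0:ℝ) < 2 * Real.pi := by positivity
  have step1 : ∀ w ∈ B, ‖F c‖ₑ ^ 2 ≤ ENNReal.ofReal ((2 * Real.pi)⁻¹) *
      ∫⁻ t in Ioc 0 (2 * Real.pi), ‖F (c + circleMap 0 1 t • w)‖ₑ ^ 2 := by
    intro w hw
    have hmaps : ∀ u ∈ closedBall (0:ℂ) 1, c + u • w ∈ ball c δ := by
      intro u hu
      simp only [mem_ball, dist_self_add_left, norm_smul]
      simp at hu
      simp [hB] at hw
      calc ‖u‖ * ‖w‖ ≤ 1 * ‖w‖ := by gcongr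
        _ < δ := by linarith
    have hd : DifferentiableOn ℂ (fun u : ℂ => F (c + u • w) ^ 2) (closedBall 0 1) := by
      apply DifferentiableOn.pow
      exact hFb.comp (by fun_prop) hmaps
    have hav : Real.circleAverage (fun u : ℂ => F (c + u • w) ^ 2) 0 1 = F c ^ 2 := by
      rw [circleAverage_of_differentiable_on_off_countable (s := ∅) countable_empty]
      · simp
      · simpa using hd.continuousOn
      · intro z hz
        simp at hz
        exact (hd z (by simpa using hz.le)).differentiableAt
          (closedBall_mem_nhds_of_mem (by simpa using hz))
    rw [Real.circleAverage_def, intervalIntegral.integral_of_le h2pi.le] at hav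
    rw [← enorm_pow, ← hav, enorm_smul]
    gcongr
    · rw [← ofReal_norm, Real.norm_of_nonneg (by positivity)]
    · refine (enorm_integral_le_lintegral_enorm _).trans ?_
      simp only [enorm_pow]; rfl
  have meas : Measurable (fun p : (ℂ × ℂ × ℂ) × ℝ => ‖F (c + circleMap 0 1 p.2 • p.1)‖ₑ ^ 2) := by
    have : Measurable (fun p : (ℂ × ℂ × ℂ) × ℝ => c + circleMap 0 1 p.2 • p.1) := by
      have : Continuous (fun p : (ℂ × ℂ × ℂ) × ℝ => c + circleMap 0 1 p.2 • p.1) := by fun_prop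
      exact this.measurable
    exact ((hm.comp this).enorm).pow_const 2
  calc volume B * ‖F c‖ₑ ^ 2 = ∫⁻ w in B, ‖F c‖ₑ ^ 2 := by
        rw [lintegral_const, mul_comm]; simp
    _ ≤ ∫⁻ w in B, ENNReal.ofReal ((2 * Real.pi)⁻¹) *
      ∫⁻ t in Ioc 0 (2 * Real.pi), ‖F (c + circleMap 0 1 t • w)‖ₑ ^ 2 :=
        setLIntegral_mono' measurableSet_ball step1
    _ = ENNReal.ofReal ((2 * Real.pi)⁻¹) * ∫⁻ w in B,
      ∫⁻ t in Ioc 0 (2 * Real.pi), ‖F (c + circleMap 0 1 t • w)‖ₑ ^ 2 :=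
        lintegral_const_mul _ (Measurable.lintegral_prod_right' meas)
    _ = ENNReal.ofReal ((2 * Real.pi)⁻¹) * ∫⁻ t in Ioc 0 (2 * Real.pi),
      ∫⁻ w in B, ‖F (c + circleMap 0 1 t • w)‖ₑ ^ 2 := by
        rw [lintegral_lintegral_swap meas.aemeasurable]
    _ ≤ ENNReal.ofReal ((2 * Real.pi)⁻¹) * ∫⁻ t in Ioc 0 (2 * Real.pi), ∫⁻ z, ‖F z‖ₑ ^ 2 := by
        refine mul_le_mul_right (lintegral_mono fun t => ?_) _
        refine (setLIntegral_le_lintegral _ _).trans ?_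
        set l : ℂ × ℂ × ℂ := (circleMap 0 1 t, circleMap 0 1 t, circleMap 0 1 t)
        have hl : ‖circleMap 0 1 t‖ = 1 := by simp
        have hl0 : circleMap 0 1 t ≠ 0 := by rw [← norm_pos_iff, hl]; norm_num
        have := lint_mul3 l hl0 hl hl (fun w => ‖F (c + w)‖ₑ ^ 2) (by fun_prop)
        have e1 : ‖l.1‖ = 1 := hl
        rw [e1, lintegral_add_left_eq_self (fun w => ‖F w‖ₑ ^ 2) c] at this
        simp at this
        refine le_of_eq (Eq.trans ?_ this)
        rfl
    _ = ∫⁻ z, ‖F z‖ₑ ^ 2 := by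
        rw [setLIntegral_const, Real.volume_Ioc, mul_comm, mul_assoc,
          ← ENNReal.ofReal_mul (by linarith)]
        rw [sub_zero, mul_inv_cancel₀ h2pi.ne']; simp

lemma diff_param {Uo : Set (ℂ × ℂ × ℂ)} (hU : IsOpen Uo) (f : ℂ × ℂ × ℂ → ℝ × ℝ × ℝ → ℂ)
    (hd : ∀ v, DifferentiableOn ℂ (fun q => f q v) Uo)
    (hm : ∀ q ∈ Uo, AEStronglyMeasurable (f q) volume)
    (hb : ∀ q0 ∈ Uo, ∃ r > 0, ∃ B : ℝ × ℝ × ℝ → ℝ, Integrable B ∧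
      ∀ q ∈ ball q0 r, ∀ v, ‖f q v‖ ≤ B v) :
    DifferentiableOn ℂ (fun q => ∫ v, f q v) Uo := by
  intro q0 hq0
  obtain ⟨r1, hr1, B, hB, hbd⟩ := hb q0 hq0
  obtain ⟨r2, hr2, hr2U⟩ := Metric.isOpen_iff.1 hU q0 hq0
  set r := min r1 r2 with hr
  have hr0 : 0 < r := lt_min hr1 hr2
  have hsub1 : ball q0 r ⊆ ball q0 r1 := ball_subset_ball (min_le_left _ _)
  have hsubU : ball q0 r ⊆ Uo := (ball_subset_ball (min_le_right _ _)).trans hr2U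
  have hsub : ∀ q ∈ ball q0 (r / 2), ball q (r / 2) ⊆ ball q0 r := by
    intro q hq
    apply ball_subset_ball'
    simp at hq; linarith
  have hda : ∀ v, ∀ q ∈ Uo, DifferentiableAt ℂ (fun q => f q v) q := fun v q hq =>
    (hd v q hq).differentiableAt (hU.mem_nhds hq)
  have hlim : ∀ e : ℂ × ℂ × ℂ,
      AEStronglyMeasurable (fun v => fderiv ℂ (fun q => f q v) q0 e) volume := by
    intro e
    have ht : Tendsto (fun n : ℕ => q0 + ((1 : ℂ) / ((n : ℂ) + 1)) • e) atTop (𝓝 q0) := by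
      have h1 : Tendsto (fun n : ℕ => (1 : ℂ) / ((n : ℂ) + 1)) atTop (𝓝 0) :=
        tendsto_one_div_add_atTop_nhds_zero_nat (𝕜 := ℂ)
      have := (h1.smul_const e).const_add q0
      simpa using this
    obtain ⟨n0, hn0⟩ := eventually_atTop.1 (ht.eventually (hU.mem_nhds hq0))
    refine aestronglyMeasurable_of_tendsto_ae (u := atTop)
      (f := fun n : ℕ => fun v => (((n + n0 : ℕ) : ℂ) + 1) •
        (f (q0 + ((1 : ℂ) / (((n + n0 : ℕ) : ℂ) + 1)) • e) v - f q0 v)) ?_ ?_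
    · intro n
      exact ((hm _ (hn0 (n + n0) (by omega))).sub (hm _ hq0)).const_smul (((n + n0 : ℕ) : ℂ) + 1)
    · refine Eventually.of_forall fun v => ?_
      have hF := (hda v q0 hq0).hasFDerivAt
      have hl : HasDerivAt (fun u : ℂ => f (q0 + u • e) v) (fderiv ℂ (fun q => f q v) q0 e) 0 := by
        have h1 : HasDerivAt (fun u : ℂ => q0 + u • e) e 0 := by
          simpa using ((hasDerivAt_id (0:ℂ)).smul_const e).const_add q0
        have hF' : HasFDerivAt (fun q => f q v) (fderiv ℂ (fun q => f q v) q0) (q0 + (0:ℂ) • e) := by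
          simpa using hF
        exact hF'.comp_hasDerivAt 0 h1
      have h2 := hl.tendsto_slope_zero
      have h3 : Tendsto (fun n : ℕ => (1 : ℂ) / (((n + n0 : ℕ) : ℂ) + 1)) atTop (𝓝[≠] 0) := by
        apply tendsto_nhdsWithin_iff.2
        refine ⟨?_, Eventually.of_forall fun n => ?_⟩
        · exact (tendsto_one_div_add_atTop_nhds_zero_nat (𝕜 := ℂ)).comp (tendsto_add_atTop_nat n0)
        · have : (((n + n0 : ℕ) : ℂ) + 1) ≠ 0 := Nat.cast_add_one_ne_zero _
          simp only [mem_compl_iff, mem_singleton_iff]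
          exact one_div_ne_zero this
      have h4 := h2.comp h3
      refine h4.congr fun n => ?_
      simp
  have hF'm : AEStronglyMeasurable (fun v => fderiv ℂ (fun q => f q v) q0) volume := by
    let p1 : (ℂ × ℂ × ℂ) →L[ℂ] ℂ := ContinuousLinearMap.fst ℂ ℂ (ℂ × ℂ)
    let p2 : (ℂ × ℂ × ℂ) →L[ℂ] ℂ :=
      (ContinuousLinearMap.fst ℂ ℂ ℂ).comp (ContinuousLinearMap.snd ℂ ℂ (ℂ × ℂ))
    let p3 : (ℂ × ℂ × ℂ) →L[ℂ] ℂ :=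
      (ContinuousLinearMap.snd ℂ ℂ ℂ).comp (ContinuousLinearMap.snd ℂ ℂ (ℂ × ℂ))
    have : (fun v => fderiv ℂ (fun q => f q v) q0) = fun v =>
        (fderiv ℂ (fun q => f q v) q0 (1, 0, 0)) • p1 +
        (fderiv ℂ (fun q => f q v) q0 (0, 1, 0)) • p2 +
        (fderiv ℂ (fun q => f q v) q0 (0, 0, 1)) • p3 := by
      funext v
      ext <;> simp [p1, p2, p3] <;> rfl
    rw [this]
    exact (((hlim _).smul_const _).add ((hlim _).smul_const _)).add ((hlim _).smul_const _)
  have key := hasFDerivAt_integral_of_dominated_of_fderiv_le (𝕜 := ℂ) (μ := volume)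
    (F := f) (F' := fun q v => fderiv ℂ (fun q => f q v) q) (x₀ := q0)
    (s := ball q0 (r / 2)) (bound := fun v => (2 * B v) / (r / 2))
    (ball_mem_nhds _ (by linarith))
    (eventually_of_mem (hU.mem_nhds hq0) hm)
    (hB.mono' (hm _ hq0) (Eventually.of_forall fun v => hbd _ (mem_ball_self hr1) v))
    hF'm ?_ ((hB.const_mul 2).div_const _) ?_
  · exact key.differentiableAt.differentiableWithinAt
  · refine Eventually.of_forall fun v q hq => ?_
    apply norm_fderiv_le_div_of_mapsTo_ball
    · exact (hd v).mono ((hsub q hq).trans hsubU)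
    · intro q' hq'
      rw [mem_closedBall, dist_eq_norm]
      have a1 := hbd q' (hsub1 (hsub q hq hq')) v
      have a2 := hbd q (hsub1 (hsub q hq (mem_ball_self (by linarith)))) v
      exact (norm_sub_le _ _).trans (by linarith)
    · linarith
  · refine Eventually.of_forall fun v q hq => (hda v q ?_).hasFDerivAt
    exact hsubU (ball_subset_ball (by linarith) hq)

end Worm

namespace Worm

open Topology Filter Metric Set
open scoped ENNReal

lemma int_gauss {b : ℝ} (hb : 0 < b) :
    Integrable (fun v : ℝ × ℝ × ℝ => Real.exp (-b * (v.1 ^ 2 + v.2.1 ^ 2 + v.2.2 ^ 2))) := by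
  have h := integrable_exp_neg_mul_sq hb
  have h3 : Integrable (fun v : ℝ × ℝ × ℝ => Real.exp (-b * v.1 ^ 2) *
      (Real.exp (-b * v.2.1 ^ 2) * Real.exp (-b * v.2.2 ^ 2)))
      ((volume : Measure ℝ).prod ((volume : Measure ℝ).prod (volume : Measure ℝ))) :=
    h.mul_prod (h.mul_prod h)
  refine h3.congr (Eventually.of_forall fun v => ?_)
  simp only [← Real.exp_add]
  congr 1; ring

/-- complex Gaussian -/
noncomputable def gk (w : ℂ × ℂ × ℂ) : ℂ := exp (-(w.1 ^ 2 + w.2.1 ^ 2 + w.2.2 ^ 2))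

lemma gk_diff : Differentiable ℂ gk := by unfold gk; fun_prop

lemma gk_norm (w : ℂ × ℂ × ℂ) : ‖gk w‖ =
    Real.exp (-(w.1.re ^ 2 + w.2.1.re ^ 2 + w.2.2.re ^ 2) +
      (w.1.im ^ 2 + w.2.1.im ^ 2 + w.2.2.im ^ 2)) := by
  rw [gk, norm_exp]
  congr 1
  simp [pow_two]; ring

lemma gk_bound (v : ℝ × ℝ × ℝ) (w : ℂ × ℂ × ℂ) :
    ‖gk (cv v + w)‖ ≤ Real.exp (-(1/2) * (v.1 ^ 2 + v.2.1 ^ 2 + v.2.2 ^ 2)) *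
      Real.exp (3 * ‖w‖ ^ 2) := by
  rw [gk_norm, ← Real.exp_add, Real.exp_le_exp]
  simp only [cv, Prod.fst_add, Prod.snd_add, add_re, add_im, ofReal_re, ofReal_im, zero_add]
  have h1 : ‖w.1‖ ^ 2 ≤ ‖w‖ ^ 2 := by gcongr; exact norm_fst_le w
  have h2 : ‖w.2.1‖ ^ 2 ≤ ‖w‖ ^ 2 := by
    gcongr; exact (norm_fst_le w.2).trans (norm_snd_le w)
  have h3 : ‖w.2.2‖ ^ 2 ≤ ‖w‖ ^ 2 := by
    gcongr; exact (norm_snd_le w.2).trans (norm_snd_le w)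
  rw [← normSq_eq_norm_sq, normSq_apply] at h1 h2 h3
  nlinarith [sq_nonneg (v.1 + 2 * w.1.re), sq_nonneg (v.2.1 + 2 * w.2.1.re),
    sq_nonneg (v.2.2 + 2 * w.2.2.re)]

/-- pull back to the tube -/
noncomputable def P (F : ℂ × ℂ × ℂ → ℂ) (w : ℂ × ℂ × ℂ) : ℂ := exp w.1 * F (Ex w)

lemma P_meas {F : ℂ × ℂ × ℂ → ℂ} (hF : Measurable F) : Measurable (P F) := by
  unfold P
  have := hF.comp Ex_cont.measurable
  have h2 : Measurable (fun w : ℂ × ℂ × ℂ => exp w.1) := by fun_prop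
  exact h2.mul this

lemma P_diff {μ : ℝ} {F : ℂ × ℂ × ℂ → ℂ} (hF : DifferentiableOn ℂ F (Dmod μ)) :
    DifferentiableOn ℂ (P F) (Tube μ) := by
  unfold P
  have : DifferentiableOn ℂ (fun w => F (Ex w)) (Tube μ) :=
    hF.comp Ex_diff.differentiableOn (fun w hw => Ex_mem hw)
  exact (Differentiable.differentiableOn (by fun_prop)).mul this

lemma P_add_cv (F : ℂ × ℂ × ℂ → ℂ) (q : ℂ × ℂ × ℂ) (v : ℝ × ℝ × ℝ) :
    P F (q + cv v) = exp q.1 * U F v (Ex q) := by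
  rw [P, U, Ex_add, mul_comm (Ex q)]
  simp only [Prod.fst_add, exp_add, cv]
  ring

lemma P_bound {μ : ℝ} {F : ℂ × ℂ × ℂ → ℂ} (hm : Measurable F)
    (hF : DifferentiableOn ℂ F (Dmod μ)) (hN : ∫⁻ z, ‖F z‖ₑ ^ 2 ≠ ∞)
    {q0 : ℂ × ℂ × ℂ} (hq0 : q0 ∈ Tube μ) :
    ∃ r > 0, ∃ C, 0 ≤ C ∧ ∀ q ∈ ball q0 r, ∀ v, ‖P F (q + cv v)‖ ≤ C := by
  obtain ⟨d, hd, hdD⟩ := Metric.isOpen_iff.1 (D_open μ) (Ex q0) (Ex_mem hq0)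
  obtain ⟨r, hr, hrE⟩ := Metric.continuousAt_iff.1 (Ex_cont.continuousAt (x := q0)) (d / 2)
    (by linarith)
  set Vb := volume (ball (0 : ℂ × ℂ × ℂ) (d / 2)) with hVb
  have hV0 : Vb ≠ 0 := (measure_ball_pos _ _ (by linarith)).ne'
  set N := ∫⁻ z, ‖F z‖ₑ ^ 2 with hNd
  set K := (N / Vb).toReal with hK
  refine ⟨r, hr, Real.exp (‖q0‖ + r) * (K + 1), by positivity, ?_⟩
  intro q hq v
  rw [P_add_cv, norm_mul]
  have hEq : dist (Ex q) (Ex q0) < d / 2 := hrE hq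
  have hball : ball (Ex q) (d / 2) ⊆ Dmod μ := by
    refine (ball_subset_ball' ?_).trans hdD
    linarith
  have hUd : DifferentiableOn ℂ (U F v) (Dmod μ) := by
    unfold U
    have : DifferentiableOn ℂ (fun z => F (Ex (cv v) * z)) (Dmod μ) :=
      hF.comp (by fun_prop) (fun z hz => (D_mul_iff v z).2 hz)
    exact this.const_mul _
  have hb := bergman (U_meas' hm v) hUd hball
  rw [U_unitary hm, ← hVb, ← hNd, mul_comm] at hb
  have hb2 : ‖U F v (Ex q)‖ₑ ^ 2 ≤ N / Vb :=
    (ENNReal.le_div_iff_mul_le (Or.inl hV0) (Or.inr hN)).2 hb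
  have hfin : N / Vb ≠ ∞ := ENNReal.div_ne_top hN hV0
  have hb3 : ‖U F v (Ex q)‖ ^ 2 ≤ K := by
    have := ENNReal.toReal_mono hfin hb2
    rw [ENNReal.toReal_pow, toReal_enorm] at this; exact this
  have hK0 : 0 ≤ K := ENNReal.toReal_nonneg
  have hb4 : ‖U F v (Ex q)‖ ≤ K + 1 := by nlinarith [norm_nonneg (U F v (Ex q))]
  have hb5 : ‖exp q.1‖ ≤ Real.exp (‖q0‖ + r) := by
    rw [norm_exp, Real.exp_le_exp]
    have h1 : q.1.re ≤ ‖q‖ := (re_le_norm _).trans (norm_fst_le q)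
    have h2 : ‖q‖ ≤ ‖q0‖ + ‖q - q0‖ := by
      have := norm_add_le q0 (q - q0)
      simpa using this
    rw [mem_ball, dist_eq_norm] at hq
    linarith
  gcongr

lemma cv_smul (a : ℝ) (v : ℝ × ℝ × ℝ) : cv (a • v) = (a : ℂ) • cv v := by
  simp [cv]

lemma contour {μ : ℝ} {F : ℂ × ℂ × ℂ → ℂ} (hm : Measurable F)
    (hF : DifferentiableOn ℂ F (Dmod μ)) (hN : ∫⁻ z, ‖F z‖ₑ ^ 2 ≠ ∞) (hμ : 0 < μ)
    {η : ℝ} (hη : η ≠ 0) {p : ℂ × ℂ × ℂ} (hp : p ∈ Tube μ) :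
    ∫ v, P F (p + cv (η • v)) * gk (cv v)
      = ∫ v, P F (cv (η • v)) * gk (cv v - (η⁻¹ : ℂ) • p) := by
  set J : ℂ × ℂ × ℂ → ℂ := fun q =>
    ∫ v, P F (q + cv (η • v)) * gk (cv v + (η⁻¹ : ℂ) • (q - p)) with hJ
  have hJd : DifferentiableOn ℂ J (Tube μ) := by
    apply diff_param (Tube_open μ)
    · intro v
      have h1 : DifferentiableOn ℂ (fun q => P F (q + cv (η • v))) (Tube μ) :=
        (P_diff hF).comp (by fun_prop) (fun q hq => (Tube_add_cv _).2 hq)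
      have h2 : Differentiable ℂ (fun q => gk (cv v + (η⁻¹ : ℂ) • (q - p))) :=
        gk_diff.comp (by fun_prop)
      exact h1.mul h2.differentiableOn
    · intro q _
      have h1 : Measurable (fun v => P F (q + cv (η • v))) :=
        (P_meas hm).comp (by
          have : Continuous (fun v => q + cv (η • v)) :=
            continuous_const.add (cv_cont.comp (by fun_prop))
          exact this.measurable)
      have h2 : Continuous (fun v => gk (cv v + (η⁻¹ : ℂ) • (q - p))) :=
        gk_diff.continuous.comp (cv_cont.add continuous_const)
      exact (h1.mul h2.measurable).aestronglyMeasurable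
    · intro q0 hq0
      obtain ⟨r, hr, C, hC, hb⟩ := P_bound hm hF hN hq0
      refine ⟨r, hr, fun v => C * (Real.exp (-(1/2) * (v.1 ^ 2 + v.2.1 ^ 2 + v.2.2 ^ 2)) *
        Real.exp (3 * (‖(η⁻¹ : ℂ)‖ * (‖q0 - p‖ + r)) ^ 2)),
        ((int_gauss (by norm_num)).mul_const _).const_mul _, ?_⟩
      intro q hq v
      rw [norm_mul]
      refine mul_le_mul ?_ ?_ (norm_nonneg _) hC
      · exact hb q hq _
      · refine (gk_bound _ _).trans ?_
        gcongr
        rw [norm_smul]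
        gcongr
        rw [mem_ball, dist_eq_norm] at hq
        have := norm_add_le (q0 - p) (q - q0)
        have e : q0 - p + (q - q0) = q - p := by abel
        rw [e] at this
        linarith
  have hη' : (η : ℂ) ≠ 0 := by exact_mod_cast hη
  have hJinv : ∀ q r, J (q + cv r) = J q := by
    intro q r
    simp only [hJ]
    rw [← integral_add_left_eq_self
      (fun v => P F (q + cv (η • v)) * gk (cv v + (η⁻¹ : ℂ) • (q - p))) (η⁻¹ • r)]
    congr 1
    funext v
    congr 2
    · rw [smul_add, smul_inv_smul₀ hη, cv_add]; abel
    · rw [cv_add, cv_smul]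
      push_cast
      simp only [smul_sub, smul_add]
      abel
  have hJf : (Tube μ).EqOn (fderiv ℂ J) 0 := by
    intro q hq
    have hd := ((hJd q hq).differentiableAt ((Tube_open μ).mem_nhds hq)).hasFDerivAt
    have key : ∀ r, fderiv ℂ J q (cv r) = 0 := by
      intro r
      have h1 : HasDerivAt (fun u : ℝ => q + u • cv r) (cv r) 0 := by
        simpa using ((hasDerivAt_id (0:ℝ)).smul_const (cv r)).const_add q
      have h2 : HasFDerivAt J ((fderiv ℂ J q).restrictScalars ℝ) (q + (0:ℝ) • cv r) := by
        simpa using hd.restrictScalars ℝ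
      have h3 := h2.comp_hasDerivAt 0 h1
      have h4 : (J ∘ fun u : ℝ => q + u • cv r) = fun _ => J q := by
        funext u
        have : u • cv r = cv (u • r) := by rw [cv_smul]; rfl
        simp only [Function.comp, this, hJinv]
      rw [h4] at h3
      have := h3.unique (hasDerivAt_const _ _)
      simpa using this
    have e1 := key (1, 0, 0)
    have e2 := key (0, 1, 0)
    have e3 := key (0, 0, 1)
    simp only [cv, ofReal_one, ofReal_zero] at e1 e2 e3
    apply ContinuousLinearMap.ext
    intro w
    have hw : w = w.1 • ((1, 0, 0) : ℂ × ℂ × ℂ) + w.2.1 • ((0, 1, 0) : ℂ × ℂ × ℂ) +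
        w.2.2 • ((0, 0, 1) : ℂ × ℂ × ℂ) := by simp
    rw [hw]
    simp only [map_add, map_smul, e1, e2, e3]
    simp
  have hc := (Tube_open μ).is_const_of_fderiv_eq_zero (Tube_convex μ).isPreconnected hJd hJf
    hp (zero_mem_Tube hμ)
  simpa [hJ, sub_eq_add_neg] using hc

/-- extension -/
noncomputable def R (F : ℂ × ℂ × ℂ → ℂ) (η : ℝ) (p : ℂ × ℂ × ℂ) : ℂ :=
  ∫ v, P F (cv (η • v)) * gk (cv v - (η⁻¹ : ℂ) • p)

lemma R_diff {μ : ℝ} {F : ℂ × ℂ × ℂ → ℂ} (hm : Measurable F)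
    (hF : DifferentiableOn ℂ F (Dmod μ)) (hN : ∫⁻ z, ‖F z‖ₑ ^ 2 ≠ ∞) (hμ : 0 < μ) (η : ℝ) :
    Differentiable ℂ (R F η) := by
  rw [← differentiableOn_univ]
  unfold R
  apply diff_param isOpen_univ
  · intro v
    have h2 : Differentiable ℂ (fun p => gk (cv v - (η⁻¹ : ℂ) • p)) :=
      gk_diff.comp (by fun_prop)
    exact (h2.const_mul _).differentiableOn
  · intro q _
    have h1 : Measurable (fun v => P F (cv (η • v))) :=
      (P_meas hm).comp (by
        have : Continuous (fun v => cv (η • v)) := cv_cont.comp (by fun_prop)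
        exact this.measurable)
    have h2 : Continuous (fun v => gk (cv v - (η⁻¹ : ℂ) • q)) :=
      gk_diff.continuous.comp (cv_cont.sub continuous_const)
    exact (h1.mul h2.measurable).aestronglyMeasurable
  · intro q0 _
    obtain ⟨r, hr, C, hC, hb⟩ := P_bound hm hF hN (zero_mem_Tube hμ)
    refine ⟨1, one_pos, fun v => C * (Real.exp (-(1/2) * (v.1 ^ 2 + v.2.1 ^ 2 + v.2.2 ^ 2)) *
      Real.exp (3 * (‖(η⁻¹ : ℂ)‖ * (‖q0‖ + 1)) ^ 2)),
      ((int_gauss (by norm_num)).mul_const _).const_mul _, ?_⟩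
    intro q hq v
    rw [norm_mul]
    refine mul_le_mul ?_ ?_ (norm_nonneg _) hC
    · simpa using hb 0 (mem_ball_self hr) (η • v)
    · rw [sub_eq_add_neg]
      refine (gk_bound _ _).trans ?_
      gcongr
      rw [norm_neg, norm_smul]
      gcongr
      rw [mem_ball, dist_eq_norm] at hq
      have := norm_add_le q0 (q - q0)
      have e : q0 + (q - q0) = q := by abel
      rw [e] at this
      linarith

lemma R_bound {μ : ℝ} {F : ℂ × ℂ × ℂ → ℂ} (hm : Measurable F)
    (hF : DifferentiableOn ℂ F (Dmod μ)) (hN : ∫⁻ z, ‖F z‖ₑ ^ 2 ≠ ∞) (hμ : 0 < μ) (η A : ℝ) :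
    ∃ C, 0 ≤ C ∧ ∀ p : ℂ × ℂ × ℂ, |p.1.im| ≤ A → |p.2.1.im| ≤ A → |p.2.2.im| ≤ A →
      ‖R F η p‖ ≤ C := by
  obtain ⟨r, hr, C, hC, hb⟩ := P_bound hm hF hN (zero_mem_Tube hμ)
  set g : ℝ × ℝ × ℝ → ℝ := fun v => Real.exp (-1 * (v.1 ^ 2 + v.2.1 ^ 2 + v.2.2 ^ 2)) with hg
  have hgi : Integrable g := int_gauss one_pos
  refine ⟨∫ v, C * (g v * Real.exp (3 * (η⁻¹ * A) ^ 2)), by positivity, ?_⟩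
  intro p h1 h2 h3
  set x : ℝ × ℝ × ℝ := (-(η⁻¹ * p.1.re), -(η⁻¹ * p.2.1.re), -(η⁻¹ * p.2.2.re)) with hx
  have hIntg : Integrable (fun v => C * (g v * Real.exp (3 * (η⁻¹ * A) ^ 2))) :=
    (hgi.mul_const _).const_mul _
  rw [← integral_add_left_eq_self _ x]
  unfold R
  apply norm_integral_le_of_norm_le (hIntg.comp_add_left x)
  refine Eventually.of_forall fun v => ?_
  rw [norm_mul]
  gcongr
  · simpa using hb 0 (mem_ball_self hr) (η • v)
  · rw [gk_norm, hg]
    simp only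
    rw [← Real.exp_add, Real.exp_le_exp]
    have i : ∀ w : ℂ, ((η⁻¹ : ℂ) * w).im = η⁻¹ * w.im := fun w => by
      rw [← ofReal_inv, im_ofReal_mul]
    have j : ∀ w : ℂ, ((η⁻¹ : ℂ) * w).re = η⁻¹ * w.re := fun w => by
      rw [← ofReal_inv, re_ofReal_mul]
    simp only [hx, cv, Prod.fst_sub, Prod.snd_sub, Prod.smul_fst, Prod.smul_snd, smul_eq_mul,
      sub_re, sub_im, ofReal_re, ofReal_im, i, j, Prod.fst_add, Prod.snd_add]
    have k : ∀ y : ℝ, |y| ≤ A → (0 - η⁻¹ * y) ^ 2 ≤ (η⁻¹ * A) ^ 2 := by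
      intro y hy
      have : y ^ 2 ≤ A ^ 2 := sq_le_sq' (by linarith [(abs_le.1 hy).1]) (abs_le.1 hy).2
      rw [zero_sub, neg_sq, mul_pow, mul_pow]
      gcongr
    have := k _ h1
    have := k _ h2
    have := k _ h3
    nlinarith

lemma P_period (F : ℂ × ℂ × ℂ → ℂ) (w w' : ℂ × ℂ × ℂ) (h1 : w.1 = w'.1)
    (h : Ex w = Ex w') : P F w = P F w' := by
  rw [P, P, h1, h]

lemma R_period (F : ℂ × ℂ × ℂ → ℂ) {η : ℝ} (hη : η ≠ 0) (w w' : ℂ × ℂ × ℂ) (h1 : w.1 = w'.1)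
    (h2 : exp (I * w.2.1) = exp (I * w'.2.1)) (h3 : exp (I * w.2.2) = exp (I * w'.2.2)) :
    R F η w = R F η w' := by
  obtain ⟨n, hn⟩ := exp_eq_exp_iff_exists_int.1 h2
  obtain ⟨m, hm⟩ := exp_eq_exp_iff_exists_int.1 h3
  have e2 : w.2.1 = w'.2.1 + ((n * (2 * Real.pi) : ℝ) : ℂ) := by
    apply mul_left_cancel₀ I_ne_zero
    rw [hn]; push_cast; ring
  have e3 : w.2.2 = w'.2.2 + ((m * (2 * Real.pi) : ℝ) : ℂ) := by
    apply mul_left_cancel₀ I_ne_zero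
    rw [hm]; push_cast; ring
  set t : ℝ × ℝ × ℝ := (0, n * (2 * Real.pi), m * (2 * Real.pi)) with ht
  have hw : w = w' + cv t := by
    refine Prod.ext ?_ (Prod.ext ?_ ?_)
    · simp [cv, ht, h1]
    · simpa [cv, ht] using e2
    · simpa [cv, ht] using e3
  have hExt : Ex (cv t) = 1 := by
    have q : ∀ n : ℤ, exp (I * ((n * (2 * Real.pi) : ℝ) : ℂ)) = 1 := fun n => by
      rw [exp_eq_one_iff]
      exact ⟨n, by push_cast; ring⟩
    refine Prod.ext ?_ (Prod.ext ?_ ?_)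
    · simp [Ex, cv, ht]
    · exact q n
    · exact q m
  unfold R
  rw [← integral_add_left_eq_self (fun v => P F (cv (η • v)) * gk (cv v - (η⁻¹ : ℂ) • w)) (η⁻¹ • t)]
  congr 1
  funext v
  congr 1
  · rw [smul_add, smul_inv_smul₀ hη]
    apply P_period
    · simp [cv, ht]
    · rw [cv_add, Ex_add, hExt, one_mul]
  · congr 1
    rw [cv_add, cv_smul, hw]
    push_cast
    rw [smul_add]
    abel

end Worm

namespace Worm

open Topology Filter Metric Set
open scoped ENNReal

lemma cs_lint {α : Type*} [MeasurableSpace α] (ν : Measure α) {a k : α → ℝ≥0∞}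
    (ha : Measurable a) (hk : Measurable k) :
    (∫⁻ x, a x * k x ∂ν) ^ 2 ≤ (∫⁻ x, a x ^ 2 ∂ν) * ∫⁻ x, k x ^ 2 ∂ν := by
  have h := ENNReal.lintegral_mul_le_Lp_mul_Lq ν (Real.HolderConjugate.two_two)
    ha.aemeasurable hk.aemeasurable
  simp only [Pi.mul_apply, ENNReal.rpow_two] at h
  calc (∫⁻ x, a x * k x ∂ν) ^ 2 ≤ _ := pow_le_pow_left' h 2
    _ = _ := by
      rw [mul_pow]
      congr 1 <;>
      · rw [← ENNReal.rpow_two, ← ENNReal.rpow_mul]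
        norm_num

/-- normalization -/
noncomputable def c0 : ℂ := ∫ v, gk (cv v)

lemma gk_cv (v : ℝ × ℝ × ℝ) :
    gk (cv v) = ((Real.exp (-1 * (v.1 ^ 2 + v.2.1 ^ 2 + v.2.2 ^ 2)) : ℝ) : ℂ) := by
  simp [gk, cv]

lemma gk_cv_cont : Continuous (fun v => gk (cv v)) := gk_diff.continuous.comp cv_cont

lemma gk_cv_int : Integrable (fun v => gk (cv v)) := by
  simp only [gk_cv]
  exact (int_gauss one_pos).ofReal

lemma c0_ne : c0 ≠ 0 := by
  unfold c0
  simp only [gk_cv]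
  rw [integral_complex_ofReal, ofReal_ne_zero]
  have : NeZero (volume : Measure (ℝ × ℝ × ℝ)) := by
    constructor
    intro h
    have h2 := measure_ball_pos (volume : Measure (ℝ × ℝ × ℝ)) 0 one_pos
    rw [h] at h2
    simp at h2
  exact (integral_exp_pos (int_gauss one_pos)).ne'

lemma gk_lint : ∫⁻ v, ‖gk (cv v)‖ₑ ≠ ∞ := gk_cv_int.2.ne

lemma jensen {f : ℝ × ℝ × ℝ → ℂ} (hf : Measurable f) :
    ‖∫ v, f v * gk (cv v)‖ₑ ^ 2
      ≤ (∫⁻ v, ‖f v‖ₑ ^ 2 * ‖gk (cv v)‖ₑ) * ∫⁻ v, ‖gk (cv v)‖ₑ := by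
  set k : ℝ × ℝ × ℝ → ℂ := fun v =>
    ((Real.exp (-(1/2) * (v.1 ^ 2 + v.2.1 ^ 2 + v.2.2 ^ 2)) : ℝ) : ℂ) with hk
  have hkm : Measurable k := by
    have : Continuous k := by fun_prop
    exact this.measurable
  have hk2 : ∀ v, ‖gk (cv v)‖ₑ = ‖k v‖ₑ ^ 2 := by
    intro v
    rw [gk_cv, hk, ← enorm_pow]
    congr 1
    simp only
    rw [← ofReal_pow, ← Real.exp_nat_mul]
    congr 2
    push_cast
    ring
  simp only [hk2]
  have h1 : ‖∫ v, f v * gk (cv v)‖ₑ ≤ ∫⁻ v, (‖f v‖ₑ * ‖k v‖ₑ) * ‖k v‖ₑ := by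
    refine (enorm_integral_le_lintegral_enorm _).trans (le_of_eq ?_)
    congr 1
    funext v
    rw [enorm_mul, hk2, pow_two, mul_assoc]
  refine (pow_le_pow_left' h1 2).trans ?_
  refine (cs_lint volume (by fun_prop) (by fun_prop)).trans (le_of_eq ?_)
  simp only [mul_pow]

lemma dist_bound {F : ℂ × ℂ × ℂ → ℂ} (hm : Measurable F) (v : ℝ × ℝ × ℝ) :
    ∫⁻ z, ‖U F v z - F z‖ₑ ^ 2 ≤ 4 * ∫⁻ z, ‖F z‖ₑ ^ 2 := by
  have m1 := U_meas' hm v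
  calc ∫⁻ z, ‖U F v z - F z‖ₑ ^ 2 ≤ ∫⁻ z, (2 * ‖U F v z‖ₑ ^ 2 + 2 * ‖F z‖ₑ ^ 2) := by
        apply lintegral_mono
        intro z
        have h2 : (2 : ℝ≥0∞) = ENNReal.ofReal 2 := by simp
        simp only [← ofReal_norm]
        simp only [h2, ← ENNReal.ofReal_pow (norm_nonneg _)]
        rw [← ENNReal.ofReal_mul (by norm_num), ← ENNReal.ofReal_mul (by norm_num),
          ← ENNReal.ofReal_add (by positivity) (by positivity)]
        apply ENNReal.ofReal_le_ofReal
        have := parallelogram_law_with_norm ℝ (U F v z) (F z)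
        nlinarith [sq_nonneg ‖U F v z + F z‖]
    _ = _ := by
      rw [lintegral_add_left (by fun_prop), lintegral_const_mul _ (by fun_prop),
        lintegral_const_mul _ (by fun_prop), U_unitary hm, ← add_mul]
      norm_num

lemma avg_tendsto {μ : ℝ} {F : ℂ × ℂ × ℂ → ℂ} (hm : Measurable F) (hF : ContinuousOn F (Dmod μ))
    (h0 : ∀ z, z ∉ Dmod μ → F z = 0) (hN : ∫⁻ z, ‖F z‖ₑ ^ 2 ≠ ∞) {η : ℕ → ℝ}
    (hη : Tendsto η atTop (𝓝 0)) :
    Tendsto (fun n => ∫⁻ v, (∫⁻ z, ‖U F (η n • v) z - F z‖ₑ ^ 2) * ‖gk (cv v)‖ₑ) atTop (𝓝 0) := by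
  have hgm : Measurable (fun v => ‖gk (cv v)‖ₑ) := gk_cv_cont.measurable.enorm
  have h := tendsto_lintegral_of_dominated_convergence (μ := (volume : Measure (ℝ × ℝ × ℝ)))
    (F := fun n v => (∫⁻ z, ‖U F (η n • v) z - F z‖ₑ ^ 2) * ‖gk (cv v)‖ₑ) (f := fun _ => 0)
    (fun v => (4 * ∫⁻ z, ‖F z‖ₑ ^ 2) * ‖gk (cv v)‖ₑ) ?_ ?_ ?_ ?_
  · simpa using h
  · intro n
    refine Measurable.mul ?_ hgm
    have m1 : Measurable (fun p : (ℝ × ℝ × ℝ) × (ℂ × ℂ × ℂ) => U F (η n • p.1) p.2) :=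
      (U_meas hm).comp (by fun_prop : Measurable
        (fun p : (ℝ × ℝ × ℝ) × (ℂ × ℂ × ℂ) => ((η n • p.1, p.2) : (ℝ × ℝ × ℝ) × (ℂ × ℂ × ℂ))))
    have m2 : Measurable (fun p : (ℝ × ℝ × ℝ) × (ℂ × ℂ × ℂ) =>
      ‖U F (η n • p.1) p.2 - F p.2‖ₑ ^ 2) := by fun_prop
    exact m2.lintegral_prod_right'
  · intro n
    refine Eventually.of_forall fun v => ?_
    exact mul_le_mul_left (dist_bound hm _) _
  · rw [lintegral_const_mul _ hgm]
    exact ENNReal.mul_ne_top (ENNReal.mul_ne_top (by norm_num) hN) gk_lint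
  · refine Eventually.of_forall fun v => ?_
    have hv : Tendsto (fun n => η n • v) atTop (𝓝 0) := by
      simpa using hη.smul_const v
    have := ENNReal.Tendsto.mul_const (b := ‖gk (cv v)‖ₑ) (U_tendsto hm hF h0 hN hv)
      (Or.inr enorm_ne_top)
    simpa using this

/-- approximants -/
noncomputable def Gs (F : ℂ × ℂ × ℂ → ℂ) (s η : ℝ) (z : ℂ × ℂ × ℂ) : ℂ :=
  exp (-(s : ℂ) * (Lam z).1 ^ 2 - (Lam z).1) * (c0⁻¹ * R F η (Lam z))

/-- damping factor -/
noncomputable def ef (s : ℝ) (z : ℂ × ℂ × ℂ) : ℂ := exp (-(s : ℂ) * (Lam z).1 ^ 2)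

lemma ef_meas (s : ℝ) : Measurable (ef s) := by
  unfold ef
  have c : Continuous (fun w : ℂ × ℂ × ℂ => exp (-(s : ℂ) * w.1 ^ 2)) := by fun_prop
  exact c.measurable.comp Lam_meas

lemma Lam_im {μ : ℝ} {z : ℂ × ℂ × ℂ} (hz : z ∈ Dmod μ) :
    |(Lam z).1.im| ≤ Real.pi / 2 + 2 * μ ∧ |(Lam z).2.1.im| ≤ Real.pi / 2 + 2 * μ ∧
      |(Lam z).2.2.im| ≤ Real.pi / 2 + 2 * μ := by
  obtain ⟨h1, h2, h3⟩ := Lam_mem hz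
  have := Real.pi_pos
  rw [abs_lt] at h1 h2 h3
  refine ⟨?_, ?_, ?_⟩ <;> rw [abs_le] <;> constructor <;> linarith [h1.1, h1.2, h2.1, h2.2, h3.1, h3.2]

lemma ef_bound {μ s : ℝ} (hs : 0 ≤ s) {z : ℂ × ℂ × ℂ} (hz : z ∈ Dmod μ) :
    ‖ef s z‖ ≤ Real.exp (s * (Real.pi / 2 + 2 * μ) ^ 2) := by
  rw [ef, norm_exp, Real.exp_le_exp, neg_mul, neg_re, re_ofReal_mul]
  have h := (Lam_im hz).1
  have h2 := sq_le_sq' (by linarith [(abs_le.1 h).1]) (abs_le.1 h).2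
  have e : ((Lam z).1 ^ 2).re = (Lam z).1.re ^ 2 - (Lam z).1.im ^ 2 := by
    rw [pow_two, mul_re]; ring
  rw [e]
  nlinarith [mul_nonneg hs (sub_nonneg.2 h2), mul_nonneg hs (sq_nonneg (Lam z).1.re)]

lemma Gs_diff {μ : ℝ} {F : ℂ × ℂ × ℂ → ℂ} (hm : Measurable F)
    (hF : DifferentiableOn ℂ F (Dmod μ)) (hN : ∫⁻ z, ‖F z‖ₑ ^ 2 ≠ ∞) (hμ : 0 < μ) (s : ℝ)
    {η : ℝ} (hη : η ≠ 0) (μ' : ℝ) : DifferentiableOn ℂ (Gs F s η) (Dmod μ') := by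
  refine holo_Lam (h := fun w => exp (-(s : ℂ) * w.1 ^ 2 - w.1) * (c0⁻¹ * R F η w)) ?_ ?_
  · exact Differentiable.mul (by fun_prop) ((R_diff hm hF hN hμ η).const_mul _)
  · intro w w' h1 h2 h3
    rw [R_period F hη w w' h1 h2 h3, h1]

lemma Gs_eq {μ : ℝ} {F : ℂ × ℂ × ℂ → ℂ} (hm : Measurable F)
    (hF : DifferentiableOn ℂ F (Dmod μ)) (hN : ∫⁻ z, ‖F z‖ₑ ^ 2 ≠ ∞) (hμ : 0 < μ) (s : ℝ)
    {η : ℝ} (hη : η ≠ 0) {z : ℂ × ℂ × ℂ} (hz : z ∈ Dmod μ) :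
    Gs F s η z - ef s z * F z
      = ef s z * (c0⁻¹ * ∫ v, (U F (η • v) z - F z) * gk (cv v)) := by
  have hc := contour hm hF hN hμ hη (Lam_mem hz)
  obtain ⟨r, hr, C, hC, hb⟩ := P_bound hm hF hN (Lam_mem hz)
  have hPU : ∀ v, P F (Lam z + cv v) = exp (Lam z).1 * U F v z := by
    intro v
    rw [P_add_cv, Ex_Lam hz]
  have hUb : ∀ v, ‖U F v z‖ ≤ ‖exp (-(Lam z).1)‖ * C := by
    intro v
    have e : U F v z = exp (-(Lam z).1) * P F (Lam z + cv v) := by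
      rw [hPU, ← mul_assoc, ← exp_add]; simp
    rw [e, norm_mul]
    gcongr
    exact hb _ (mem_ball_self hr) v
  have hmU : Measurable (fun v : ℝ × ℝ × ℝ => U F (η • v) z) :=
    (U_meas hm).comp (by fun_prop : Measurable
      (fun v : ℝ × ℝ × ℝ => ((η • v, z) : (ℝ × ℝ × ℝ) × (ℂ × ℂ × ℂ))))
  have hi : Integrable (fun v => U F (η • v) z * gk (cv v)) :=
    gk_cv_int.bdd_mul hmU.aestronglyMeasurable (Eventually.of_forall fun v => hUb _)
  have hR : R F η (Lam z) = exp (Lam z).1 * ∫ v, U F (η • v) z * gk (cv v) := by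
    rw [R, ← hc, ← integral_const_mul]
    congr 1
    funext v
    rw [hPU, mul_assoc]
  have hI : ∫ v, (U F (η • v) z - F z) * gk (cv v)
      = (∫ v, U F (η • v) z * gk (cv v)) - F z * c0 := by
    rw [c0, ← integral_const_mul, ← integral_sub hi (gk_cv_int.const_mul _)]
    congr 1
    funext v
    ring
  rw [hI, Gs, ef, hR, sub_eq_add_neg (-(s : ℂ) * (Lam z).1 ^ 2), exp_add, mul_sub c0⁻¹]
  have e1 : exp (-(Lam z).1) * exp (Lam z).1 = 1 := by rw [← exp_add]; simp
  have e2 : c0⁻¹ * c0 = 1 := inv_mul_cancel₀ c0_ne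
  generalize (∫ v, U F (η • v) z * gk (cv v)) = Q
  linear_combination (exp (-(s : ℂ) * (Lam z).1 ^ 2) * c0⁻¹ * Q) * e1 +
    (exp (-(s : ℂ) * (Lam z).1 ^ 2) * F z) * e2

lemma approx1 {μ : ℝ} {F : ℂ × ℂ × ℂ → ℂ} (hm : Measurable F)
    (hF : DifferentiableOn ℂ F (Dmod μ)) (h0 : ∀ z, z ∉ Dmod μ → F z = 0)
    (hN : ∫⁻ z, ‖F z‖ₑ ^ 2 ≠ ∞) (hμ : 0 < μ) {s : ℝ} (hs : 0 ≤ s) {η : ℕ → ℝ}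
    (hη0 : ∀ n, η n ≠ 0) (hη : Tendsto η atTop (𝓝 0)) :
    Tendsto (fun n => ∫⁻ z in Dmod μ, ‖Gs F s (η n) z - ef s z * F z‖ₑ ^ 2) atTop (𝓝 0) := by
  set B : ℝ≥0∞ := ENNReal.ofReal (Real.exp (s * (Real.pi / 2 + 2 * μ) ^ 2)) with hB
  set K : ℝ≥0∞ := ∫⁻ v, ‖gk (cv v)‖ₑ with hK
  have hgm : Measurable (fun v => ‖gk (cv v)‖ₑ) := gk_cv_cont.measurable.enorm
  have hbd : ∀ n, ∫⁻ z in Dmod μ, ‖Gs F s (η n) z - ef s z * F z‖ₑ ^ 2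
      ≤ (B ^ 2 * ‖c0⁻¹‖ₑ ^ 2 * K) *
        ∫⁻ v, (∫⁻ z, ‖U F (η n • v) z - F z‖ₑ ^ 2) * ‖gk (cv v)‖ₑ := by
    intro n
    have m1 : Measurable (fun p : (ℂ × ℂ × ℂ) × (ℝ × ℝ × ℝ) => U F (η n • p.2) p.1) :=
      (U_meas hm).comp (by fun_prop : Measurable
        (fun p : (ℂ × ℂ × ℂ) × (ℝ × ℝ × ℝ) => ((η n • p.2, p.1) : (ℝ × ℝ × ℝ) × (ℂ × ℂ × ℂ))))
    have m2 : Measurable (fun p : (ℂ × ℂ × ℂ) × (ℝ × ℝ × ℝ) =>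
      ‖U F (η n • p.2) p.1 - F p.1‖ₑ ^ 2 * ‖gk (cv p.2)‖ₑ) := by
      have : Measurable (fun p : (ℂ × ℂ × ℂ) × (ℝ × ℝ × ℝ) => ‖gk (cv p.2)‖ₑ) :=
        hgm.comp measurable_snd
      refine Measurable.mul (by fun_prop) this
    calc ∫⁻ z in Dmod μ, ‖Gs F s (η n) z - ef s z * F z‖ₑ ^ 2
        ≤ ∫⁻ z in Dmod μ, (B ^ 2 * ‖c0⁻¹‖ₑ ^ 2 * K) *
            ∫⁻ v, ‖U F (η n • v) z - F z‖ₑ ^ 2 * ‖gk (cv v)‖ₑ := by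
          apply setLIntegral_mono' (D_open μ).measurableSet
          intro z hz
          rw [Gs_eq hm hF hN hμ s (hη0 n) hz, enorm_mul, enorm_mul, mul_pow, mul_pow]
          have b1 : ‖ef s z‖ₑ ≤ B := by
            rw [← ofReal_norm]
            exact ENNReal.ofReal_le_ofReal (ef_bound hs hz)
          have b2 := jensen (f := fun v => U F (η n • v) z - F z)
            ((m1.comp (measurable_const.prodMk measurable_id : Measurable
              (fun v : ℝ × ℝ × ℝ => (z, v)))).sub measurable_const)
          calc _ ≤ B ^ 2 * (‖c0⁻¹‖ₑ ^ 2 *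
              ((∫⁻ v, ‖U F (η n • v) z - F z‖ₑ ^ 2 * ‖gk (cv v)‖ₑ) * K)) := by gcongr
            _ = _ := by ring
      _ ≤ ∫⁻ z, (B ^ 2 * ‖c0⁻¹‖ₑ ^ 2 * K) *
            ∫⁻ v, ‖U F (η n • v) z - F z‖ₑ ^ 2 * ‖gk (cv v)‖ₑ := setLIntegral_le_lintegral _ _
      _ = (B ^ 2 * ‖c0⁻¹‖ₑ ^ 2 * K) *
            ∫⁻ z, ∫⁻ v, ‖U F (η n • v) z - F z‖ₑ ^ 2 * ‖gk (cv v)‖ₑ :=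
          lintegral_const_mul _ m2.lintegral_prod_right'
      _ = _ := by
          congr 1
          rw [lintegral_lintegral_swap m2.aemeasurable]
          congr 1
          funext v
          rw [lintegral_mul_const]
          have := m1.comp (measurable_id.prodMk measurable_const : Measurable
              (fun z : ℂ × ℂ × ℂ => (z, v)))
          exact ((this.sub hm).enorm).pow_const 2
  have ht := ENNReal.Tendsto.const_mul (a := B ^ 2 * ‖c0⁻¹‖ₑ ^ 2 * K)
    (avg_tendsto hm hF.continuousOn h0 hN hη) (Or.inr ?_)
  · rw [mul_zero] at ht
    exact tendsto_of_tendsto_of_tendsto_of_le_of_le tendsto_const_nhds ht (fun _ => zero_le) hbd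
  · refine ENNReal.mul_ne_top (ENNReal.mul_ne_top ?_ ?_) gk_lint
    · exact ENNReal.pow_ne_top ENNReal.ofReal_ne_top
    · exact ENNReal.pow_ne_top enorm_ne_top

lemma approx2 {μ : ℝ} {F : ℂ × ℂ × ℂ → ℂ} (hm : Measurable F)
    (hN : ∫⁻ z, ‖F z‖ₑ ^ 2 ≠ ∞) {s : ℕ → ℝ} (hs0 : ∀ n, 0 ≤ s n) (hs1 : ∀ n, s n ≤ 1)
    (hs : Tendsto s atTop (𝓝 0)) :
    Tendsto (fun n => ∫⁻ z in Dmod μ, ‖ef (s n) z * F z - F z‖ₑ ^ 2) atTop (𝓝 0) := by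
  set B : ℝ := Real.exp ((Real.pi / 2 + 2 * μ) ^ 2) + 1 with hB
  have h := tendsto_lintegral_of_dominated_convergence
    (μ := (volume : Measure (ℂ × ℂ × ℂ)).restrict (Dmod μ))
    (F := fun n z => ‖ef (s n) z * F z - F z‖ₑ ^ 2) (f := fun _ => 0)
    (fun z => ENNReal.ofReal B ^ 2 * ‖F z‖ₑ ^ 2) ?_ ?_ ?_ ?_
  · simpa using h
  · intro n
    have := ef_meas (s n)
    fun_prop
  · intro n
    refine (ae_restrict_iff' (D_open μ).measurableSet).2 (Eventually.of_forall fun z hz => ?_)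
    have e : ef (s n) z * F z - F z = (ef (s n) z - 1) * F z := by ring
    simp only
    rw [e, enorm_mul, mul_pow]
    gcongr
    rw [← ofReal_norm]
    apply ENNReal.ofReal_le_ofReal
    refine (norm_sub_le _ _).trans ?_
    rw [norm_one, hB]
    gcongr
    refine (ef_bound (hs0 n) hz).trans ?_
    rw [Real.exp_le_exp]
    nlinarith [sq_nonneg (Real.pi / 2 + 2 * μ), hs1 n]
  · rw [lintegral_const_mul _ (by fun_prop)]
    refine ENNReal.mul_ne_top (ENNReal.pow_ne_top ENNReal.ofReal_ne_top) ?_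
    exact ((setLIntegral_le_lintegral _ _).trans_lt (lt_top_iff_ne_top.2 hN)).ne
  · refine Eventually.of_forall fun z => ?_
    have c : Continuous (fun s : ℝ => ‖exp (-(s : ℂ) * (Lam z).1 ^ 2) * F z - F z‖ₑ ^ 2) := by
      refine (ENNReal.continuous_pow 2).comp ?_
      refine continuous_enorm.comp ?_
      fun_prop
    have := (c.tendsto 0).comp hs
    simpa [Function.comp_def, ef] using this

end Worm

namespace Worm

open Topology Filter Metric Set
open scoped ENNReal

lemma real_bound {s x : ℝ} (hs : 0 < s) :
    Real.exp (-s * x ^ 2 - x) ^ 2 * (1 + Real.exp x) ^ 4 ≤ 16 * Real.exp (9 / (2 * s)) := by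
  have h1 : 1 + Real.exp x ≤ 2 * Real.exp |x| := by
    have a := Real.one_le_exp (abs_nonneg x)
    have b := Real.exp_le_exp.2 (le_abs_self x)
    linarith
  have h2 : (1 + Real.exp x) ^ 4 ≤ (2 * Real.exp |x|) ^ 4 := by gcongr
  have h3 : (2 * Real.exp |x|) ^ 4 = 16 * Real.exp (4 * |x|) := by
    rw [mul_pow, ← Real.exp_nat_mul]; norm_num
  have h4 : Real.exp (-s * x ^ 2 - x) ^ 2 = Real.exp (2 * (-s * x ^ 2 - x)) := by
    rw [← Real.exp_nat_mul]; norm_num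
  rw [h4]
  calc _ ≤ Real.exp (2 * (-s * x ^ 2 - x)) * (16 * Real.exp (4 * |x|)) := by
        rw [← h3]; gcongr
    _ = 16 * Real.exp (2 * (-s * x ^ 2 - x) + 4 * |x|) := by rw [Real.exp_add]; ring
    _ ≤ _ := by
      gcongr
      rw [le_div_iff₀ (by positivity)]
      have h5 := neg_abs_le x
      have h6 : x ^ 2 = |x| ^ 2 := (sq_abs x).symm
      rw [h6]
      nlinarith [sq_nonneg (2 * s * |x| - 3), abs_nonneg x]

lemma D_ball {μ : ℝ} {z : ℂ × ℂ × ℂ} (hz : z ∈ Dmod μ) :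
    z.2.1 ∈ ball (0 : ℂ) (Real.exp μ + 1) ∧ z.2.2 ∈ ball (0 : ℂ) (Real.exp μ + 1) := by
  obtain ⟨h2, h3, -, -, a, -, b⟩ := hz
  have key : ∀ w : ℂ, w ≠ 0 → Real.log (‖w‖ ^ 2) < μ → w ∈ ball (0 : ℂ) (Real.exp μ + 1) := by
    intro w hw h
    have hp : 0 < ‖w‖ := norm_pos_iff.2 hw
    rw [Real.log_lt_iff_lt_exp (by positivity)] at h
    rw [mem_ball_zero_iff]
    nlinarith [Real.exp_pos μ]
  exact ⟨key _ h2 a, key _ h3 b⟩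

lemma Gs_L2 {μ : ℝ} {F : ℂ × ℂ × ℂ → ℂ} (hm : Measurable F)
    (hF : DifferentiableOn ℂ F (Dmod μ)) (hN : ∫⁻ z, ‖F z‖ₑ ^ 2 ≠ ∞) (hμ : 0 < μ) {s : ℝ}
    (hs : 0 < s) {η : ℝ} (hη : η ≠ 0) (μ' : ℝ) :
    IntegrableOn (fun z => ‖Gs F s η z‖ ^ 2) (Dmod μ') volume := by
  set A := Real.pi / 2 + 2 * μ' with hA
  obtain ⟨C, hC, hR⟩ := R_bound hm hF hN hμ η A
  set ρ := Real.exp μ' + 1 with hρ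
  set M : ℝ := Real.exp (s * A ^ 2) ^ 2 * (16 * Real.exp (9 / (2 * s))) * (‖c0⁻¹‖ * C) ^ 2 with hM
  have i1 : Integrable (fun z : ℂ => (1 + ‖z‖) ^ (-(4:ℝ))) :=
    integrable_one_add_norm (by rw [Complex.finrank_real_complex]; norm_num)
  have i2 : Integrable ((ball (0:ℂ) ρ).indicator (fun _ => (1:ℝ))) :=
    (integrable_indicator_iff measurableSet_ball).2
      (integrableOn_const (measure_ball_lt_top).ne)
  have i3 : Integrable (fun z : ℂ × ℂ × ℂ => M * ((1 + ‖z.1‖) ^ (-(4:ℝ)) *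
      ((ball (0:ℂ) ρ).indicator (fun _ => (1:ℝ)) z.2.1 *
        (ball (0:ℂ) ρ).indicator (fun _ => (1:ℝ)) z.2.2)))
      ((volume : Measure ℂ).prod ((volume : Measure ℂ).prod (volume : Measure ℂ))) :=
    (i1.mul_prod (i2.mul_prod i2)).const_mul M
  have i4 : Integrable (fun z : ℂ × ℂ × ℂ => M * ((1 + ‖z.1‖) ^ (-(4:ℝ)) *
      ((ball (0:ℂ) ρ).indicator (fun _ => (1:ℝ)) z.2.1 *
        (ball (0:ℂ) ρ).indicator (fun _ => (1:ℝ)) z.2.2))) := i3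
  have hc : ContinuousOn (fun z => ‖Gs F s η z‖ ^ 2) (Dmod μ') :=
    ((Gs_diff hm hF hN hμ s hη μ').continuousOn.norm).pow 2
  refine Integrable.mono' i4.integrableOn
    (hc.aestronglyMeasurable (D_open μ').measurableSet) ?_
  refine (ae_restrict_iff' (D_open μ').measurableSet).2 (Eventually.of_forall fun z hz => ?_)
  obtain ⟨b2, b3⟩ := D_ball hz
  rw [indicator_of_mem b2, indicator_of_mem b3, mul_one, mul_one, Real.norm_of_nonneg (by positivity)]
  obtain ⟨j1, j2, j3⟩ := Lam_im hz
  have hR' := hR _ j1 j2 j3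
  have hz1 : 0 < ‖z.1‖ := norm_pos_iff.2 (D_fst_ne hz)
  set x := Real.log ‖z.1‖ with hx
  have hex : Real.exp x = ‖z.1‖ := Real.exp_log hz1
  have hE : ‖exp (-(s : ℂ) * (Lam z).1 ^ 2 - (Lam z).1)‖
      ≤ Real.exp (s * A ^ 2) * Real.exp (-s * x ^ 2 - x) := by
    have h1 := ef_bound hs.le hz
    rw [norm_exp, ← Real.exp_add, Real.exp_le_exp, sub_re, neg_mul, neg_re, re_ofReal_mul, Lam_re]
    have h2 := sq_le_sq' (by linarith [(abs_le.1 j1).1]) (abs_le.1 j1).2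
    have e : ((Lam z).1 ^ 2).re = (Lam z).1.re ^ 2 - (Lam z).1.im ^ 2 := by
      rw [pow_two, mul_re]; ring
    rw [e, Lam_re, ← hx]
    rw [← hA] at h2
    nlinarith [mul_nonneg hs.le (sub_nonneg.2 h2)]
  have hG : ‖Gs F s η z‖ ≤ (Real.exp (s * A ^ 2) * Real.exp (-s * x ^ 2 - x)) * (‖c0⁻¹‖ * C) := by
    rw [Gs, norm_mul, norm_mul]
    gcongr
  have hrb := real_bound (x := x) hs
  rw [Real.rpow_neg (by positivity), show (4:ℝ) = ((4:ℕ):ℝ) by norm_num, Real.rpow_natCast,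
    ← div_eq_mul_inv, le_div_iff₀ (by positivity), ← hex]
  calc ‖Gs F s η z‖ ^ 2 * (1 + Real.exp x) ^ 4
      ≤ ((Real.exp (s * A ^ 2) * Real.exp (-s * x ^ 2 - x)) * (‖c0⁻¹‖ * C)) ^ 2
        * (1 + Real.exp x) ^ 4 := by gcongr
    _ = Real.exp (s * A ^ 2) ^ 2 * (Real.exp (-s * x ^ 2 - x) ^ 2 * (1 + Real.exp x) ^ 4)
        * (‖c0⁻¹‖ * C) ^ 2 := by ring
    _ ≤ M := by rw [hM]; gcongr

lemma enorm_split (a b c : ℂ) : ‖a - c‖ₑ ^ 2 ≤ 2 * ‖a - b‖ₑ ^ 2 + 2 * ‖b - c‖ₑ ^ 2 := by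
  have h2 : (2 : ℝ≥0∞) = ENNReal.ofReal 2 := by simp
  simp only [← ofReal_norm]
  simp only [h2, ← ENNReal.ofReal_pow (norm_nonneg _)]
  rw [← ENNReal.ofReal_mul (by norm_num), ← ENNReal.ofReal_mul (by norm_num),
    ← ENNReal.ofReal_add (by positivity) (by positivity)]
  apply ENNReal.ofReal_le_ofReal
  have h := norm_add_le (a - b) (b - c)
  rw [sub_add_sub_cancel] at h
  nlinarith [sq_nonneg (‖a - b‖ - ‖b - c‖), norm_nonneg (a - c), norm_nonneg (a - b),
    norm_nonneg (b - c)]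

lemma main0 {μ : ℝ} {F : ℂ × ℂ × ℂ → ℂ} (hm : Measurable F)
    (hF : DifferentiableOn ℂ F (Dmod μ)) (h0 : ∀ z, z ∉ Dmod μ → F z = 0)
    (hN : ∫⁻ z, ‖F z‖ₑ ^ 2 ≠ ∞) (hμ : 0 < μ) (μ' : ℝ) {ε : ℝ} (hε : 0 < ε) :
    ∃ G, DifferentiableOn ℂ G (Dmod μ') ∧
      IntegrableOn (fun z => ‖G z‖ ^ 2) (Dmod μ') volume ∧
      DifferentiableOn ℂ G (Dmod μ) ∧
      (∫⁻ z in Dmod μ, ‖G z - F z‖ₑ ^ 2) < ENNReal.ofReal ε := by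
  set t : ℕ → ℝ := fun n => 1 / ((n : ℝ) + 1) with ht
  have t0 : ∀ n, 0 < t n := fun n => by simp only [ht]; positivity
  have t1 : ∀ n, t n ≤ 1 := fun n => by
    simp only [ht]
    rw [div_le_one (by positivity)]
    linarith [Nat.cast_nonneg (α := ℝ) n]
  have tt : Tendsto t atTop (𝓝 0) := tendsto_one_div_add_atTop_nhds_zero_nat
  have hε4 : (0 : ℝ≥0∞) < ENNReal.ofReal (ε / 4) := by
    rw [ENNReal.ofReal_pos]; linarith
  obtain ⟨n, hn⟩ := ((approx2 (μ := μ) hm hN (fun n => (t0 n).le) t1 tt).eventually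
    (gt_mem_nhds hε4)).exists
  obtain ⟨k, hk⟩ := ((approx1 hm hF h0 hN hμ (t0 n).le (fun k => (t0 k).ne') tt).eventually
    (gt_mem_nhds hε4)).exists
  have hd := Gs_diff hm hF hN hμ (t n) (t0 k).ne'
  refine ⟨Gs F (t n) (t k), hd μ', Gs_L2 hm hF hN hμ (t0 n) (t0 k).ne' μ', hd μ, ?_⟩
  have hmb : Measurable (fun z => 2 * ‖ef (t n) z * F z - F z‖ₑ ^ 2) := by
    have := ef_meas (t n)
    fun_prop
  calc ∫⁻ z in Dmod μ, ‖Gs F (t n) (t k) z - F z‖ₑ ^ 2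
      ≤ ∫⁻ z in Dmod μ, (2 * ‖Gs F (t n) (t k) z - ef (t n) z * F z‖ₑ ^ 2 +
          2 * ‖ef (t n) z * F z - F z‖ₑ ^ 2) := lintegral_mono fun z => enorm_split _ _ _
    _ = 2 * (∫⁻ z in Dmod μ, ‖Gs F (t n) (t k) z - ef (t n) z * F z‖ₑ ^ 2) +
          2 * ∫⁻ z in Dmod μ, ‖ef (t n) z * F z - F z‖ₑ ^ 2 := by
        rw [lintegral_add_right _ hmb, lintegral_const_mul' _ _ (by norm_num),
          lintegral_const_mul' _ _ (by norm_num)]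
    _ < 2 * ENNReal.ofReal (ε / 4) + 2 * ENNReal.ofReal (ε / 4) := by
        refine ENNReal.add_lt_add ?_ ?_
        · exact (ENNReal.mul_lt_mul_iff_right (by norm_num) (by norm_num)).2 hk
        · exact (ENNReal.mul_lt_mul_iff_right (by norm_num) (by norm_num)).2 hn
    _ = ENNReal.ofReal ε := by
        have h2 : (2 : ℝ≥0∞) = ENNReal.ofReal 2 := by simp
        rw [h2, ← ENNReal.ofReal_mul (by norm_num), ← ENNReal.ofReal_add (by linarith) (by linarith)]
        congr 1
        ring

lemma main1 (μ μ' : ℝ) (hμ : 0 < μ) (F : ℂ × ℂ × ℂ → ℂ)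
    (hF : DifferentiableOn ℂ F (Dmod μ))
    (hFL2 : IntegrableOn (fun z => ‖F z‖ ^ 2) (Dmod μ) volume) (ε : ℝ) (hε : 0 < ε) :
    ∃ G : ℂ × ℂ × ℂ → ℂ, DifferentiableOn ℂ G (Dmod μ') ∧
      IntegrableOn (fun z => ‖G z‖ ^ 2) (Dmod μ') volume ∧
      (∫ z in Dmod μ, ‖G z - F z‖ ^ 2) < ε := by
  have hD := (D_open μ).measurableSet
  set F0 := (Dmod μ).indicator F with hF0
  have hEq : EqOn F0 F (Dmod μ) := fun z hz => indicator_of_mem hz F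
  have hm : Measurable F0 := by
    refine measurable_of_isOpen fun O hO => ?_
    have h1 := hF.continuousOn.isOpen_inter_preimage (D_open μ) hO
    have h2 : F0 ⁻¹' O = (Dmod μ ∩ F ⁻¹' O) ∪ ((Dmod μ)ᶜ ∩ {z | (0:ℂ) ∈ O}) := by
      ext z
      by_cases hz : z ∈ Dmod μ <;> simp [hF0, hz]
    rw [h2]
    exact h1.measurableSet.union (hD.compl.inter (MeasurableSet.const _))
  have hN : ∫⁻ z, ‖F0 z‖ₑ ^ 2 ≠ ∞ := by
    have h1 : (fun z => ‖F0 z‖ₑ ^ 2) = (Dmod μ).indicator (fun z => ‖F z‖ₑ ^ 2) := by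
      funext z
      by_cases hz : z ∈ Dmod μ <;> simp [hF0, hz]
    rw [h1, lintegral_indicator hD]
    have h2 := hFL2.2
    rw [HasFiniteIntegral] at h2
    refine ne_of_lt (lt_of_le_of_lt (le_of_eq ?_) h2)
    congr 1
    funext z
    rw [enorm_pow, enorm_norm]
  obtain ⟨G, g1, g2, g3, g4⟩ := main0 hm (hF.congr hEq) (fun z hz => indicator_of_notMem hz F)
    hN hμ μ' hε
  refine ⟨G, g1, g2, ?_⟩
  have hc : ContinuousOn (fun z => ‖G z - F z‖ ^ 2) (Dmod μ) :=
    ((g3.continuousOn.sub hF.continuousOn).norm).pow 2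
  rw [integral_eq_lintegral_of_nonneg_ae (Eventually.of_forall fun z => by positivity)
    (hc.aestronglyMeasurable hD)]
  have e : ∫⁻ z in Dmod μ, ENNReal.ofReal (‖G z - F z‖ ^ 2)
      = ∫⁻ z in Dmod μ, ‖G z - F0 z‖ₑ ^ 2 := by
    refine setLIntegral_congr_fun hD fun z hz => ?_
    rw [hEq hz, ENNReal.ofReal_pow (norm_nonneg _), ofReal_norm]
  rw [e]
  exact (ENNReal.lt_ofReal_iff_toReal_lt (ne_top_of_lt g4)).1 g4

end Worm

/-- For `0 < μ < μ'`, the restriction map `A²(D_{μ'}) → A²(D_μ)` has dense image: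
every `F` holomorphic and square-integrable on `D_μ` can be `L²(D_μ)`-approximated by
functions holomorphic and square-integrable on `D_{μ'}`. -/
theorem restriction_dense (μ μ' : ℝ) (hμ : 0 < μ) (hμμ' : μ < μ')
    (F : ℂ × ℂ × ℂ → ℂ) (hF : DifferentiableOn ℂ F (Dmod μ))
    (hFL2 : IntegrableOn (fun z => ‖F z‖ ^ 2) (Dmod μ) volume)
    (ε : ℝ) (hε : 0 < ε) :
    ∃ G : ℂ × ℂ × ℂ → ℂ, DifferentiableOn ℂ G (Dmod μ') ∧
      IntegrableOn (fun z => ‖G z‖ ^ 2) (Dmod μ') volume ∧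
      (∫ z in Dmod μ, ‖G z - F z‖ ^ 2) < ε := by
  exact Worm.main1 μ μ' hμ F hF hFL2 ε hε
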